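/- arXiv:1809.00714 — 2 statements merged into one kernel-verified Lean document; each statement's English description precedes it below -/
import Mathlib

section
/- The ε-stochastic solution equals the ε-mean value solution: u_ε = v_ε on all of Ω_ε. In particular, the ε-stochastic solution satisfies the dynamic programming principle u_ε(x₀) = M^ε u_ε(x₀) for every x₀ ∈ closure(Ω). -/
open MeasureTheory Metric Set
open scoped ENNReal NNReal Classical

noncomputable section

abbrev EucN (N : ℕ) := EuclideanSpace ℝ (Fin N)

variable {N : ℕ}

/-- The directional mean value operator `M^ε_ξ v (x)`. -/
def mveOp (q ε : ℝ) (v : EucN N → ℝ) (ξ x : EucN N) : ℝ :=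
  q * (⨍ y in ball x ε, v y) + (1 - q) * ((v (x + ε • ξ) + v (x - ε • ξ)) / 2)

/-- The mean value operator `M^ε v (x) = sup_{|ξ|=1} M^ε_ξ v (x)`. -/
def mvOp (q ε : ℝ) (v : EucN N → ℝ) (x : EucN N) : ℝ :=
  ⨆ ξ : sphere (0 : EucN N) 1, mveOp q ε v (ξ : EucN N) x

/-- `Ω_ε = {x : dist(x,Ω) ≤ ε}`. -/
def Oeps (Ω : Set (EucN N)) (ε : ℝ) : Set (EucN N) := {x | Metric.infDist x Ω ≤ ε}

/-- `Γ_ε = Ω_ε \ closure Ω`. -/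
def Geps (Ω : Set (EucN N)) (ε : ℝ) : Set (EucN N) := Oeps Ω ε \ closure Ω

/-- `v` is an `ε`-mean value solution with boundary data `F`. -/
def IsMVS (q ε : ℝ) (Ω : Set (EucN N)) (F v : EucN N → ℝ) : Prop :=
  Measurable v ∧ (∃ C, ∀ x ∈ Oeps Ω ε, |v x| ≤ C) ∧ EqOn v F (Geps Ω ε) ∧
    LowerSemicontinuousOn v (closure Ω) ∧ ∀ x ∈ closure Ω, v x = mvOp q ε v x

/-- exterior corkscrew condition, satisfied by bounded Lipschitz domains -/
def Corkscrew (Ω : Set (EucN N)) (δbar μ : ℝ) : Prop :=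
  ∀ δ, 0 < δ → δ < δbar → ∀ y ∈ frontier Ω, ∃ z, closedBall z (μ * δ) ⊆ ball y δ \ Ω

/-- a Borel control with values in the unit sphere -/
def IsControl (σ : EucN N → EucN N) : Prop := Measurable σ ∧ ∀ x, ‖σ x‖ = 1

/-- the transition probability measures `γ_σ[x]` -/
def gamKer (q ε : ℝ) (Ω : Set (EucN N)) (σ : EucN N → EucN N) (x : EucN N) :
    Measure (EucN N) :=
  if x ∈ closure Ω then
    ENNReal.ofReal q • ((volume (ball x ε))⁻¹ • volume.restrict (ball x ε)) +
      ENNReal.ofReal ((1 - q) / 2) •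
        (Measure.dirac (x + ε • σ x) + Measure.dirac (x - ε • σ x))
  else Measure.dirac x

/-- probability of the cylinder `{ω : ω i ∈ A i, i ≤ n}` for the chain started at `x`
with transitions `γ`. -/
def cylProb (γ : EucN N → Measure (EucN N)) : ℕ → EucN N → (ℕ → Set (EucN N)) → ℝ≥0∞
  | 0, x, A => (A 0).indicator 1 x
  | n + 1, x, A => (A 0).indicator 1 x * ∫⁻ y, cylProb γ n y (fun i => A (i + 1)) ∂(γ x)

/-- `P` is the trajectory (Ionescu-Tulcea/Kolmogorov) measure of the chain started at
`x₀` with transition kernel `γ`. -/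
def IsTrajMeasure (γ : EucN N → Measure (EucN N)) (x₀ : EucN N)
    (P : Measure (ℕ → EucN N)) : Prop :=
  IsProbabilityMeasure P ∧
    ∀ (n : ℕ) (A : ℕ → Set (EucN N)), (∀ i, MeasurableSet (A i)) →
      P {ω | ∀ i ≤ n, ω i ∈ A i} = cylProb γ n x₀ A

/-- `F(x_τ)`, the boundary value at the exit point (junk value `0` if the trajectory
never exits into `Γ`). -/
def exitVal (Γ : Set (EucN N)) (F : EucN N → ℝ) (ω : ℕ → EucN N) : ℝ :=
  if ∃ n, ω n ∈ Γ then F (ω (sInf {n | ω n ∈ Γ})) else 0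

/-- the ε-stochastic solution `u_ε(x₀) = sup_σ E^{x₀}_σ [F(x_{τ_σ})]`. -/
def stochSol (q ε : ℝ) (Ω : Set (EucN N)) (F : EucN N → ℝ) (x₀ : EucN N) : ℝ :=
  sSup {r | ∃ (σ : EucN N → EucN N) (P : Measure (ℕ → EucN N)), IsControl σ ∧
    IsTrajMeasure (gamKer q ε Ω σ) x₀ P ∧ r = ∫ ω, exitVal (Geps Ω ε) F ω ∂P}

theorem exists_measurable_selector {X Y : Type*} [TopologicalSpace X] [MeasurableSpace X]
    [BorelSpace X] [MetricSpace Y] [CompactSpace Y] [Nonempty Y] [MeasurableSpace Y]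
    [BorelSpace Y] {C : Set (X × Y)} (hC : IsClosed C) :
    ∃ s : X → Y, Measurable s ∧ ∀ x y, (x, y) ∈ C → (x, s x) ∈ C := by
  obtain ⟨g, hg, hgs⟩ := exists_nat_bool_continuous_surjective_of_compact Y
  let f : cantorSet → Y := g ∘ cantorSetHomeomorphNatToBool
  have hf : Continuous f := hg.comp cantorSetHomeomorphNatToBool.continuous
  have hfs : Function.Surjective f := hgs.comp cantorSetHomeomorphNatToBool.surjective
  have : CompactSpace cantorSet := isCompact_iff_compactSpace.1 isCompact_cantorSet
  let T : X → Set ℝ := fun x => Subtype.val '' {t : cantorSet | (x, f t) ∈ C}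
  have hT : ∀ x, IsCompact (T x) := fun x =>
    ((hC.preimage (by fun_prop : Continuous fun t : cantorSet => (x, f t))).isCompact).image
      continuous_subtype_val
  have hproj : ∀ Z : Set (X × cantorSet), IsClosed Z → MeasurableSet (Prod.fst '' Z) :=
    fun Z hZ => (isClosedMap_fst_of_compactSpace Z hZ).measurableSet
  have hCf : IsClosed {p : X × cantorSet | (p.1, f p.2) ∈ C} :=
    hC.preimage (by fun_prop)
  have hne : MeasurableSet {x | (T x).Nonempty} := by
    convert hproj _ hCf using 1
    ext x
    simp [T, Set.Nonempty]
  have ht : Measurable fun x => sInf (T x) := by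
    refine measurable_of_Iic fun a => ?_
    have hD := hproj _ (hCf.inter (isClosed_le (continuous_subtype_val.comp continuous_snd)
      (continuous_const (y := a))))
    have : (fun x => sInf (T x)) ⁻¹' Iic a =
        ({x | (T x).Nonempty} ∩
          Prod.fst '' ({p : X × cantorSet | (p.1, f p.2) ∈ C} ∩ {p | (p.2 : ℝ) ≤ a})) ∪
        ({x | (T x).Nonempty}ᶜ ∩ {_x | 0 ≤ a}) := by
      ext x
      simp only [mem_preimage, mem_Iic, mem_union, mem_inter_iff, mem_ofPred_eq, mem_compl_iff]
      by_cases h : (T x).Nonempty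
      · simp only [h, true_and, not_true_eq_false, false_and, or_false]
        constructor
        · intro hle
          obtain ⟨t, htC, hte⟩ := (hT x).sInf_mem h
          exact ⟨(x, t), ⟨htC, by simpa [hte] using hle⟩, rfl⟩
        · rintro ⟨⟨x', t⟩, ⟨h1, h2⟩, rfl⟩
          exact (csInf_le (hT _).bddBelow ⟨t, h1, rfl⟩).trans h2
      · simp [not_nonempty_iff_eq_empty.1 h]
    rw [this]
    exact (hne.inter hD).union (hne.compl.inter (MeasurableSet.const _))
  let G : ℝ → Y := fun t => if h : t ∈ cantorSet then f ⟨t, h⟩ else Classical.arbitrary Y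
  have hG : Measurable G := by
    refine Measurable.dite (s := cantorSet) (f := f) (g := fun _ => Classical.arbitrary Y)
      hf.measurable measurable_const isClosed_cantorSet.measurableSet
  refine ⟨fun x => G (sInf (T x)), hG.comp ht, fun x y hxy => ?_⟩
  obtain ⟨t₀, rfl⟩ := hfs y
  obtain ⟨t, htC, hte⟩ := (hT x).sInf_mem ⟨t₀, t₀, hxy, rfl⟩
  simp only [← hte, G, Subtype.coe_prop, dite_true]
  exact htC

theorem mveOp_congr {q ε : ℝ} {S : Set (EucN N)} {v w : EucN N → ℝ} (h : EqOn v w S)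
    {x ξ : EucN N} (hb : ball x ε ⊆ S) (h1 : x + ε • ξ ∈ S) (h2 : x - ε • ξ ∈ S) :
    mveOp q ε v ξ x = mveOp q ε w ξ x := by
  unfold mveOp
  rw [h h1, h h2, setAverage_congr_fun measurableSet_ball
    (Filter.Eventually.of_forall fun y hy => h (hb hy))]

theorem measurable_ballAverage {ε : ℝ} {v : EucN N → ℝ} (hv : Measurable v) :
    Measurable fun x => ⨍ y in ball x ε, v y := by
  simp_rw [setAverage_eq, measureReal_def, Measure.addHaar_ball_center volume _ ε]
  simp_rw [smul_eq_mul]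
  refine Measurable.const_mul ?_ _
  simp_rw [← integral_indicator (measurableSet_ball)]
  have : StronglyMeasurable (Function.uncurry
      fun x y : EucN N => (ball x ε).indicator v y) := by
    refine Measurable.stronglyMeasurable ?_
    have h : MeasurableSet {p : EucN N × EucN N | dist p.2 p.1 < ε} :=
      measurableSet_lt (by fun_prop) measurable_const
    exact (hv.comp measurable_snd).indicator h
  exact this.integral_prod_right.measurable

theorem exists_nearOptimal_control {q ε : ℝ} (hq1 : q ≤ 1) (hN : 0 < N)
    {S D : Set (EucN N)} (hD : IsClosed D) {v : EucN N → ℝ} (hvm : Measurable v)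
    (hDS : ∀ x ∈ D, ∀ ξ : EucN N, ‖ξ‖ = 1 → x + ε • ξ ∈ S ∧ x - ε • ξ ∈ S)
    (hS : ∀ r : ℝ, IsSigmaCompact (S ∩ {y | r < v y}))
    {a : EucN N → ℝ} (ham : Measurable a)
    (ha : ∀ x ∈ D, ∃ ξ : EucN N, ‖ξ‖ = 1 ∧ a x < mveOp q ε v ξ x) :
    ∃ σ, IsControl σ ∧ ∀ x ∈ D, a x < mveOp q ε v (σ x) x := by
  have : Nonempty (sphere (0 : EucN N) 1) := by
    have : Nontrivial (EucN N) := by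
      have : Nonempty (Fin N) := ⟨⟨0, hN⟩⟩
      infer_instance
    exact (NormedSpace.sphere_nonempty.2 zero_le_one).to_subtype
  choose K hK hKu using fun r : ℚ => hS r
  let C : (ℚ × ℕ) × (ℚ × ℕ) → Set (EucN N × sphere (0 : EucN N) 1) := fun i =>
    {p | p.1 + ε • (p.2 : EucN N) ∈ K i.1.1 i.1.2 ∧ p.1 - ε • (p.2 : EucN N) ∈ K i.2.1 i.2.2}
  have hC : ∀ i, IsClosed (C i) := fun i =>
    ((hK _ _).isClosed.preimage (by fun_prop)).inter ((hK _ _).isClosed.preimage (by fun_prop))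
  choose s hs hsC using fun i => exists_measurable_selector (hC i)
  have hex : ∀ x ∈ D, ∃ i, a x < mveOp q ε v (s i x : EucN N) x := by
    intro x hx
    obtain ⟨ξ, hξ, hlt⟩ := ha x hx
    obtain ⟨h1, h2⟩ := hDS x hx ξ hξ
    obtain ⟨δ, hδ, hδ'⟩ : ∃ δ : ℝ, 0 < δ ∧ a x < mveOp q ε v ξ x - (1 - q) * δ := by
      refine ⟨(mveOp q ε v ξ x - a x) / (2 - q), div_pos (by linarith) (by linarith), ?_⟩
      have h2q : 0 < 2 - q := by linarith
      rw [lt_sub_iff_add_lt, ← lt_sub_iff_add_lt', mul_div_assoc', div_lt_iff₀ h2q]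
      nlinarith
    obtain ⟨r1, hr1, hr1'⟩ := exists_rat_btwn (sub_lt_self (v (x + ε • ξ)) hδ)
    obtain ⟨r2, hr2, hr2'⟩ := exists_rat_btwn (sub_lt_self (v (x - ε • ξ)) hδ)
    have m1 : x + ε • ξ ∈ ⋃ n, K r1 n := by rw [hKu]; exact ⟨h1, hr1'⟩
    have m2 : x - ε • ξ ∈ ⋃ n, K r2 n := by rw [hKu]; exact ⟨h2, hr2'⟩
    obtain ⟨n1, hn1⟩ := mem_iUnion.1 m1
    obtain ⟨n2, hn2⟩ := mem_iUnion.1 m2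
    refine ⟨((r1, n1), (r2, n2)), ?_⟩
    have hsel := hsC ((r1, n1), (r2, n2)) x ⟨ξ, by simp [hξ]⟩ ⟨hn1, hn2⟩
    set ζ := s ((r1, n1), (r2, n2)) x
    have k1 : x + ε • (ζ : EucN N) ∈ S ∩ {y | (r1 : ℝ) < v y} := by
      rw [← hKu]; exact mem_iUnion.2 ⟨_, hsel.1⟩
    have k2 : x - ε • (ζ : EucN N) ∈ S ∩ {y | (r2 : ℝ) < v y} := by
      rw [← hKu]; exact mem_iUnion.2 ⟨_, hsel.2⟩
    have e1 := k1.2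
    have e2 := k2.2
    simp only [mem_ofPred_eq] at e1 e2
    refine hδ'.trans_le ?_
    unfold mveOp
    have := mul_le_mul_of_nonneg_left (a := 1 - q)
      (by linarith : (v (x + ε • ξ) + v (x - ε • ξ)) / 2 - δ ≤
        (v (x + ε • (ζ : EucN N)) + v (x - ε • (ζ : EucN N))) / 2) (by linarith)
    linarith
  obtain ⟨e, he⟩ := exists_surjective_nat ((ℚ × ℕ) × (ℚ × ℕ))
  have hsm : ∀ n, Measurable fun x => (s (e n) x : EucN N) := fun n =>
    measurable_subtype_coe.comp (hs _)
  have hpm : ∀ n, MeasurableSet {x | x ∈ D → a x < mveOp q ε v (s (e n) x : EucN N) x} := by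
    intro n
    refine MeasurableSet.imp hD.measurableSet (measurableSet_lt ham ?_)
    unfold mveOp
    have := hsm n
    exact ((measurable_ballAverage hvm).const_mul q).add
      (((hvm.comp (by fun_prop)).add (hvm.comp (by fun_prop))).div_const 2 |>.const_mul _)
  have hfind : ∀ x, ∃ n, x ∈ D → a x < mveOp q ε v (s (e n) x : EucN N) x := by
    intro x
    by_cases hx : x ∈ D
    · obtain ⟨i, hi⟩ := hex x hx
      obtain ⟨n, rfl⟩ := he i
      exact ⟨n, fun _ => hi⟩
    · exact ⟨0, fun h => absurd h hx⟩
  refine ⟨fun x => (s (e (Nat.find (hfind x))) x : EucN N),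
    ⟨Measurable.find hsm hpm hfind, fun x => ?_⟩, fun x hx => Nat.find_spec (hfind x) hx⟩
  simp

theorem measurable_gamKer {q ε : ℝ} {Ω : Set (EucN N)} {σ : EucN N → EucN N}
    (hσ : Measurable σ) : Measurable (gamKer q ε Ω σ) := by
  refine Measurable.ite isClosed_closure.measurableSet ?_ Measure.measurable_dirac
  refine Measure.measurable_of_measurable_coe _ fun s hs => ?_
  have hball : Measurable fun x : EucN N => volume (s ∩ ball x ε) := by
    have h : MeasurableSet {p : EucN N × EucN N | p.2 ∈ s ∧ dist p.2 p.1 < ε} :=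
      (measurable_snd hs).inter
        (measurableSet_lt (f := fun p : EucN N × EucN N => dist p.2 p.1) (by fun_prop)
          measurable_const)
    exact measurable_measure_prodMk_left h
  have hdirac : ∀ g : EucN N → EucN N, Measurable g →
      Measurable fun x => Measure.dirac (g x) s := fun g hg =>
    (Measure.measurable_coe hs).comp (Measure.measurable_dirac.comp hg)
  simp only [Measure.add_apply, Measure.smul_apply, smul_eq_mul, Measure.restrict_apply hs,
    Measure.addHaar_ball_center volume _ ε]
  exact ((hball.const_mul _).const_mul _).add
    (((hdirac (fun x => x + ε • σ x) (by fun_prop)).add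
      (hdirac (fun x => x - ε • σ x) (by fun_prop))).const_mul _)

theorem isProbabilityMeasure_gamKer {q ε : ℝ} (hq0 : 0 ≤ q) (hq1 : q ≤ 1) (hε : 0 < ε)
    (Ω : Set (EucN N)) (σ : EucN N → EucN N) (x : EucN N) :
    IsProbabilityMeasure (gamKer q ε Ω σ x) := by
  unfold gamKer
  split_ifs
  · constructor
    have h0 : volume (ball x ε) ≠ 0 := (measure_ball_pos volume x hε).ne'
    have h1 : volume (ball x ε) ≠ ∞ := measure_ball_lt_top.ne
    simp only [Measure.add_apply, Measure.smul_apply, smul_eq_mul, Measure.restrict_apply_univ,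
      ENNReal.inv_mul_cancel h0 h1, measure_univ, mul_one]
    rw [one_add_one_eq_two, ← ENNReal.ofReal_ofNat, ← ENNReal.ofReal_mul (by linarith),
      ← ENNReal.ofReal_add hq0 (by linarith)]
    simp
  · infer_instance

theorem integral_gamKer_of_mem {q ε : ℝ} (hq0 : 0 ≤ q) (hq1 : q ≤ 1) (hε : 0 < ε)
    {Ω : Set (EucN N)} {σ : EucN N → EucN N} {x : EucN N} (hx : x ∈ closure Ω)
    {f : EucN N → ℝ} (hf : IntegrableOn f (ball x ε)) :
    ∫ y, f y ∂gamKer q ε Ω σ x = mveOp q ε f (σ x) x := by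
  have h0 : volume (ball x ε) ≠ 0 := (measure_ball_pos volume x hε).ne'
  have hd : ∀ a : EucN N, Integrable f (Measure.dirac a) := fun a =>
    integrable_dirac (by simp)
  have hs := (hf.smul_measure (c := (volume (ball x ε))⁻¹) (ENNReal.inv_ne_top.2 h0))
  rw [gamKer, if_pos hx, integral_add_measure (hs.smul_measure ENNReal.ofReal_ne_top)
    (((hd _).add_measure (hd _)).smul_measure ENNReal.ofReal_ne_top), integral_smul_measure,
    integral_smul_measure, integral_smul_measure, integral_add_measure (hd _) (hd _), integral_dirac,
    integral_dirac,
    ENNReal.toReal_ofReal hq0, ENNReal.toReal_ofReal (by linarith), mveOp, average,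
    Measure.restrict_apply_univ, integral_smul_measure]
  simp only [smul_eq_mul]
  ring

/-- The expectation of `g (ω n)` on the cylinder `{ω : ω i ∈ A i, i ≤ n}` for the chain started
at `x` with transitions `γ`. -/
def cylLIntegral (γ : EucN N → Measure (EucN N)) :
    ℕ → EucN N → (ℕ → Set (EucN N)) → (EucN N → ℝ≥0∞) → ℝ≥0∞
  | 0, x, A, g => (A 0).indicator 1 x * g x
  | n + 1, x, A, g =>
    (A 0).indicator 1 x * ∫⁻ y, cylLIntegral γ n y (fun i => A (i + 1)) g ∂(γ x)

theorem cylLIntegral_one (γ : EucN N → Measure (EucN N)) (n : ℕ) :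
    ∀ (x : EucN N) (A : ℕ → Set (EucN N)), cylLIntegral γ n x A (fun _ => 1) = cylProb γ n x A := by
  induction n with
  | zero => intro x A; simp [cylLIntegral, cylProb]
  | succ n ih => intro x A; simp [cylLIntegral, cylProb, ih]

theorem cylLIntegral_succ (γ : EucN N → Measure (EucN N)) (n : ℕ) (g : EucN N → ℝ≥0∞) :
    ∀ (x : EucN N) (A : ℕ → Set (EucN N)), cylLIntegral γ (n + 1) x A g =
      cylLIntegral γ n x A fun y => ∫⁻ z, (A (n + 1)).indicator 1 z * g z ∂(γ y) := by
  induction n with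
  | zero => intro x A; simp [cylLIntegral]
  | succ n ih =>
    intro x A
    rw [cylLIntegral]
    simp_rw [ih]
    rfl

theorem exists_isTrajMeasure (κ : ProbabilityTheory.Kernel (EucN N) (EucN N))
    [ProbabilityTheory.IsMarkovKernel κ] (x₀ : EucN N) : ∃ P, IsTrajMeasure κ x₀ P := by
  let κ' : (n : ℕ) → ProbabilityTheory.Kernel ((i : Finset.Iic n) → EucN N) (EucN N) :=
    fun n => κ.comap (fun h => h ⟨n, Finset.mem_Iic.2 le_rfl⟩) (measurable_pi_apply _)
  have hκ' : ∀ n, ProbabilityTheory.IsMarkovKernel (κ' n) := fun n => by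
    simp only [κ']; infer_instance
  let P : Measure (ℕ → EucN N) :=
    ProbabilityTheory.Kernel.traj (X := fun _ => EucN N) κ' 0 fun _ => x₀
  have hP : IsProbabilityMeasure P := by simp only [P]; infer_instance
  refine ⟨P, hP, ?_⟩
  have hms : ∀ (n : ℕ) (A : ℕ → Set (EucN N)), (∀ i, MeasurableSet (A i)) →
      MeasurableSet {ω : ℕ → EucN N | ∀ i ≤ n, ω i ∈ A i} := fun n A hA => by
    simp only [ofPred_forall]
    exact MeasurableSet.iInter fun i => MeasurableSet.iInter fun _ => measurable_pi_apply i (hA i)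
  have key : ∀ (n : ℕ) (A : ℕ → Set (EucN N)), (∀ i, MeasurableSet (A i)) →
      ∀ g : EucN N → ℝ≥0∞, Measurable g →
        ∫⁻ ω, {ω : ℕ → EucN N | ∀ i ≤ n, ω i ∈ A i}.indicator 1 ω * g (ω n) ∂P =
          cylLIntegral κ n x₀ A g := by
    intro n A hA
    induction n with
    | zero =>
      intro g hg
      have h := ProbabilityTheory.Kernel.traj_map_frestrictLe_apply (X := fun _ => EucN N)
        (κ := κ') 0 0 (fun _ => x₀)
      rw [ProbabilityTheory.Kernel.partialTraj_self, ProbabilityTheory.Kernel.id_apply] at h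
      let j : Finset.Iic 0 := ⟨0, Finset.mem_Iic.2 le_rfl⟩
      have hG : Measurable fun h : (i : Finset.Iic 0) → EucN N =>
          (A 0).indicator (1 : EucN N → ℝ≥0∞) (h j) * g (h j) :=
        ((measurable_one.indicator (hA 0)).comp (measurable_pi_apply j)).mul
          (hg.comp (measurable_pi_apply j))
      have h2 := congrArg (fun ν => ∫⁻ h, (A 0).indicator (1 : EucN N → ℝ≥0∞)
        (h j) * g (h j) ∂ν) h
      simp only at h2
      rw [lintegral_map hG (by fun_prop), lintegral_dirac' _ hG] at h2
      rw [cylLIntegral, ← h2]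
      refine lintegral_congr fun ω => ?_
      by_cases h0 : ω 0 ∈ A 0 <;> simp [indicator, Preorder.frestrictLe, j, h0]
    | succ n ih =>
      intro g hg
      have h := ProbabilityTheory.Kernel.partialTraj_compProd_eq_map_traj (X := fun _ => EucN N)
        (κ := κ') (Nat.zero_le n) (x₀ := fun _ => x₀)
      let B : Set (Finset.Iic n → EucN N) := {h | ∀ i : Finset.Iic n, h i ∈ A i}
      have hB : MeasurableSet B := by
        simp only [B, ofPred_forall]
        exact MeasurableSet.iInter fun i => measurable_pi_apply i (hA i)
      have hI : Measurable (B.indicator (1 : (Finset.Iic n → EucN N) → ℝ≥0∞)) :=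
        measurable_one.indicator hB
      have hgA : Measurable fun z => (A (n + 1)).indicator (1 : EucN N → ℝ≥0∞) z * g z :=
        (measurable_one.indicator (hA _)).mul hg
      have hgκ : Measurable fun y => ∫⁻ z, (A (n + 1)).indicator 1 z * g z ∂(κ y) :=
        hgA.lintegral_kernel
      rw [cylLIntegral_succ, ← ih _ hgκ]
      have hF : Measurable fun p : ((i : Finset.Iic n) → EucN N) × EucN N =>
          B.indicator (1 : (Finset.Iic n → EucN N) → ℝ≥0∞) p.1 *
            ((A (n + 1)).indicator (1 : EucN N → ℝ≥0∞) p.2 * g p.2) :=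
        (hI.comp measurable_fst).mul (hgA.comp measurable_snd)
      have h2 := congrArg (fun ν => ∫⁻ p,
        B.indicator (1 : (Finset.Iic n → EucN N) → ℝ≥0∞) p.1 *
            ((A (n + 1)).indicator (1 : EucN N → ℝ≥0∞) p.2 * g p.2) ∂ν) h
      simp only at h2
      rw [lintegral_map hF (by fun_prop), Measure.lintegral_compProd hF,
        ← ProbabilityTheory.Kernel.traj_map_frestrictLe_apply,
        lintegral_map (Measurable.lintegral_kernel_prod_right' hF) (by fun_prop)] at h2
      have hind : ∀ ω : ℕ → EucN N, B.indicator
          (1 : (Finset.Iic n → EucN N) → ℝ≥0∞) (Preorder.frestrictLe n ω) =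
            {ω : ℕ → EucN N | ∀ i ≤ n, ω i ∈ A i}.indicator 1 ω := fun ω => by
        simp [indicator, Preorder.frestrictLe, B]
      refine Eq.trans (lintegral_congr fun ω => ?_) (h2.symm.trans (lintegral_congr fun ω => ?_))
      · simp only [hind, ← mul_assoc]
        congr 1
        have : (∀ i ≤ n + 1, ω i ∈ A i) ↔ (∀ i ≤ n, ω i ∈ A i) ∧ ω (n + 1) ∈ A (n + 1) := by
          simp only [Nat.le_succ_iff, or_imp, forall_and, forall_eq]
        by_cases h1 : ∀ i ≤ n, ω i ∈ A i <;> by_cases h3 : ω (n + 1) ∈ A (n + 1) <;>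
          simp [indicator, this, h1, h3]
      · simp only [hind]
        rw [lintegral_const_mul _ hgA]
        rfl
  intro n A hA
  rw [← cylLIntegral_one, ← key n A hA _ measurable_const]
  simp [lintegral_indicator_one (hms n A hA)]

theorem kernel_pow_zero (κ : ProbabilityTheory.Kernel (EucN N) (EucN N)) :
    κ ^ 0 = ProbabilityTheory.Kernel.id := rfl

instance isMarkovKernel_pow (κ : ProbabilityTheory.Kernel (EucN N) (EucN N))
    [ProbabilityTheory.IsMarkovKernel κ] (n : ℕ) : ProbabilityTheory.IsMarkovKernel (κ ^ n) := by
  induction n with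
  | zero => rw [kernel_pow_zero]; infer_instance
  | succ n ih => rw [ProbabilityTheory.Kernel.pow_add, pow_one]; infer_instance

theorem cylProb_eq_kernel_pow (κ : ProbabilityTheory.Kernel (EucN N) (EucN N))
    {B : Set (EucN N)} (hB : MeasurableSet B) (n : ℕ) :
    ∀ x, cylProb κ n x (fun i => if i = n then B else univ) = (κ ^ n) x B := by
  induction n with
  | zero =>
    intro x
    rw [kernel_pow_zero]
    simp [cylProb, ProbabilityTheory.Kernel.id_apply, Measure.dirac_apply' _ hB]
  | succ n ih =>
    intro x
    simp only [cylProb, add_left_inj, ih]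
    rw [ProbabilityTheory.Kernel.pow_add, pow_one,
      ProbabilityTheory.Kernel.comp_apply' _ _ _ hB]
    simp

theorem IsTrajMeasure.map_eval {κ : ProbabilityTheory.Kernel (EucN N) (EucN N)} {x₀ : EucN N}
    {P : Measure (ℕ → EucN N)} (hP : IsTrajMeasure κ x₀ P) (n : ℕ) :
    P.map (fun ω => ω n) = (κ ^ n) x₀ := by
  ext B hB
  rw [Measure.map_apply (measurable_pi_apply n) hB, ← cylProb_eq_kernel_pow κ hB n x₀,
    ← hP.2 n _ fun i => by split_ifs; exacts [hB, MeasurableSet.univ]]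
  congr 1
  ext ω
  simp only [mem_preimage, mem_ofPred_eq]
  constructor
  · intro h i _
    split_ifs with hi
    · rwa [hi]
    · trivial
  · intro h
    simpa using h n le_rfl

theorem integrable_of_forall_abs_le {X : Type*} [MeasurableSpace X] {μ : Measure X}
    [IsFiniteMeasure μ] {f : X → ℝ} (hf : Measurable f) {C : ℝ} (hC : ∀ x, |f x| ≤ C) :
    Integrable f μ :=
  Integrable.of_bound hf.aestronglyMeasurable C (Filter.Eventually.of_forall hC)

theorem integral_kernel_pow_succ_le {κ : ProbabilityTheory.Kernel (EucN N) (EucN N)}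
    [ProbabilityTheory.IsMarkovKernel κ] {f g : EucN N → ℝ} (hf : Measurable f) {C : ℝ}
    (hC : ∀ x, |f x| ≤ C) (hg : Measurable g) (hgC : ∀ x, |g x| ≤ C)
    (h : ∀ x, ∫ y, f y ∂κ x ≤ f x - g x) (n : ℕ) (x : EucN N) :
    ∫ y, f y ∂(κ ^ (n + 1)) x ≤
      ∫ y, f y ∂(κ ^ n) x - ∫ y, g y ∂(κ ^ n) x := by
  rw [add_comm n 1, ProbabilityTheory.Kernel.pow_add, pow_one,
    ProbabilityTheory.Kernel.integral_comp (integrable_of_forall_abs_le hf hC),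
    ← integral_sub (integrable_of_forall_abs_le hf hC) (integrable_of_forall_abs_le hg hgC)]
  refine integral_mono ?_ ((integrable_of_forall_abs_le hf hC).sub
    (integrable_of_forall_abs_le hg hgC)) h
  refine Integrable.of_bound (C := C)
    hf.stronglyMeasurable.integral_kernel.aestronglyMeasurable
    (Filter.Eventually.of_forall fun y => ?_)
  simpa using norm_integral_le_of_norm_le_const (μ := κ y) (f := f)
    (Filter.Eventually.of_forall hC)

theorem integral_kernel_pow_le {κ : ProbabilityTheory.Kernel (EucN N) (EucN N)}
    [ProbabilityTheory.IsMarkovKernel κ] {f : EucN N → ℝ} (hf : Measurable f) {C : ℝ}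
    (hC : ∀ x, |f x| ≤ C) (h : ∀ x, ∫ y, f y ∂κ x ≤ f x) (n : ℕ) (x : EucN N) :
    ∫ y, f y ∂(κ ^ n) x ≤ f x := by
  induction n with
  | zero => rw [kernel_pow_zero]; simp [ProbabilityTheory.Kernel.id_apply]
  | succ n ih =>
    have := integral_kernel_pow_succ_le (κ := κ) hf hC measurable_zero
      (fun x => by simpa using (abs_nonneg _).trans (hC x)) (fun x => by simpa using h x) n x
    simp only [Pi.zero_apply, integral_zero, sub_zero] at this
    exact this.trans ih

theorem tendsto_kernel_pow_zero {κ : ProbabilityTheory.Kernel (EucN N) (EucN N)}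
    [ProbabilityTheory.IsMarkovKernel κ] {f : EucN N → ℝ} (hf : Measurable f) {C c : ℝ}
    (hC : ∀ x, |f x| ≤ C) (hc : 0 < c) {D : Set (EucN N)} (hD : MeasurableSet D)
    (h : ∀ x, ∫ y, f y ∂κ x ≤ f x - D.indicator (fun _ => c) x) (x : EucN N) :
    Filter.Tendsto (fun n => ((κ ^ n) x).real D) Filter.atTop (nhds 0) := by
  have hg : Measurable (D.indicator fun _ => c) := measurable_const.indicator hD
  have hstep : ∀ n, c * ((κ ^ n) x).real D ≤
      ∫ y, f y ∂(κ ^ n) x - ∫ y, f y ∂(κ ^ (n + 1)) x := fun n => by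
    have := integral_kernel_pow_succ_le (κ := κ) hf (C := max C c)
      (fun x => (hC x).trans (le_max_left _ _)) hg (fun x => ?_) h n x
    · rw [integral_indicator_const _ hD, smul_eq_mul] at this
      linarith
    · by_cases hx : x ∈ D <;> simp [hx, abs_of_pos hc, hc.le]
  have hsum : Summable fun n => c * ((κ ^ n) x).real D := by
    refine summable_of_sum_range_le (c := 2 * C) (fun n => by positivity) fun n => ?_
    refine (Finset.sum_le_sum fun i _ => hstep i).trans ?_
    rw [Finset.sum_range_sub']
    have hb : ∀ m, |∫ y, f y ∂(κ ^ m) x| ≤ C := fun m => by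
      simpa using norm_integral_le_of_norm_le_const (μ := (κ ^ m) x) (f := f)
        (Filter.Eventually.of_forall hC)
    linarith [(abs_le.1 (hb 0)).2, (abs_le.1 (hb n)).1]
  simpa [hc.ne'] using hsum.tendsto_atTop_zero.const_mul c⁻¹

theorem IsTrajMeasure.ae_succ_eq {κ : ProbabilityTheory.Kernel (EucN N) (EucN N)} {x₀ : EucN N}
    {P : Measure (ℕ → EucN N)} (hP : IsTrajMeasure κ x₀ P) {D : Set (EucN N)}
    (hD : MeasurableSet D) (hκ : ∀ x ∉ D, κ x = Measure.dirac x) :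
    ∀ᵐ ω ∂P, ∀ n, ω n ∉ D → ω (n + 1) = ω n := by
  rw [ae_all_iff]
  intro n
  have hcyl : ∀ B : Set (EucN N), MeasurableSet B → ∀ m x,
      cylProb κ (m + 1) x
        (fun i => if i = m then B \ D else if i = m + 1 then Bᶜ else univ) = 0 := by
    intro B hB m
    induction m with
    | zero =>
      intro x
      by_cases hx : x ∈ B \ D
      · simp [cylProb, hκ x hx.2, lintegral_indicator_one hB.compl,
          Measure.dirac_apply' _ hB.compl, hx.1]
      · simp [cylProb, hx]
    | succ m ih =>
      intro x
      rw [cylProb]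
      simp only [add_left_inj]
      rw [lintegral_congr ih]
      simp
  have hnull : ∀ B ∈ TopologicalSpace.countableBasis (EucN N),
      ∀ᵐ ω ∂P, ω n ∈ B \ D → ω (n + 1) ∈ B := by
    intro B hB
    have hBm := (TopologicalSpace.isOpen_of_mem_countableBasis hB).measurableSet
    have h := hP.2 (n + 1) (fun i => if i = n then B \ D else if i = n + 1 then Bᶜ else univ)
      fun i => by split_ifs; exacts [hBm.diff hD, hBm.compl, MeasurableSet.univ]
    rw [hcyl B hBm n] at h
    rw [ae_iff]
    refine measure_mono_null ?_ h
    intro ω hω i _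
    simp only [mem_ofPred_eq, Classical.not_imp] at hω
    split_ifs with h1 h2
    · rw [h1]; exact hω.1
    · rw [h2]; exact hω.2
    · trivial
  filter_upwards [(ae_ball_iff (TopologicalSpace.countable_countableBasis _)).2 hnull] with ω hω hnD
  by_contra hne
  obtain ⟨U, hU, hUn, hUs⟩ :=
    (TopologicalSpace.isBasis_countableBasis (EucN N)).exists_subset_of_mem_open
    (show ω n ∈ {ω (n + 1)}ᶜ from fun h => hne h.symm) isOpen_compl_singleton
  exact hUs (hω U hU ⟨hUn, hnD⟩) rfl

theorem exitVal_of_mem {Γ : Set (EucN N)} {F : EucN N → ℝ} {ω : ℕ → EucN N}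
    (h : ∃ n, ω n ∈ Γ) : ω (sInf {n | ω n ∈ Γ}) ∈ Γ ∧
      exitVal Γ F ω = F (ω (sInf {n | ω n ∈ Γ})) :=
  ⟨Nat.sInf_mem (s := {n | ω n ∈ Γ}) h, if_pos h⟩

theorem exitVal_congr {Γ : Set (EucN N)} {F G : EucN N → ℝ} (h : EqOn F G Γ) :
    exitVal Γ F = exitVal Γ G := by
  ext ω
  by_cases hω : ∃ n, ω n ∈ Γ
  · rw [(exitVal_of_mem hω).2, (exitVal_of_mem hω).2, h (exitVal_of_mem (F := F) hω).1]
  · simp [exitVal, hω]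

theorem IsTrajMeasure.integral_exitVal_le {κ : ProbabilityTheory.Kernel (EucN N) (EucN N)}
    [ProbabilityTheory.IsMarkovKernel κ] {x₀ : EucN N} {P : Measure (ℕ → EucN N)}
    (hP : IsTrajMeasure κ x₀ P) {D O : Set (EucN N)} (hD : MeasurableSet D)
    (hO : MeasurableSet O) (hx₀ : x₀ ∈ O) (hκD : ∀ x ∉ D, κ x = Measure.dirac x)
    (hκO : ∀ x ∈ O, κ x Oᶜ = 0)
    (hlim : Filter.Tendsto (fun n => ((κ ^ n) x₀).real D) Filter.atTop (nhds 0))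
    {f : EucN N → ℝ} (hf : Measurable f) {C : ℝ} (hC : ∀ x, |f x| ≤ C)
    (h : ∀ x, ∫ y, f y ∂κ x ≤ f x) :
    Integrable (exitVal (O \ D) f) P ∧ ∫ ω, exitVal (O \ D) f ω ∂P ≤ f x₀ := by
  have := hP.1
  have hmemO : ∀ᵐ ω ∂P, ∀ n, ω n ∈ O := by
    rw [ae_all_iff]
    intro n
    have h0 : (κ ^ n) x₀ Oᶜ = 0 := by
      induction n with
      | zero =>
        rw [kernel_pow_zero, ProbabilityTheory.Kernel.id_apply, Measure.dirac_apply' _ hO.compl]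
        simp [hx₀]
      | succ n ih =>
        rw [ProbabilityTheory.Kernel.pow_succ_apply_eq_lintegral _ _ _ hO.compl,
          lintegral_eq_zero_iff (ProbabilityTheory.Kernel.measurable_coe κ hO.compl)]
        have hae : ∀ᵐ y ∂(κ ^ n) x₀, y ∈ O := ih
        filter_upwards [hae] with y hy using hκO y hy
    rw [← hP.map_eval n, Measure.map_apply (measurable_pi_apply n) hO.compl] at h0
    exact h0
  have hexit : ∀ᵐ ω ∂P, ∃ n, ω n ∉ D := by
    rw [ae_iff]
    have hle : ∀ n, P.real {ω | ¬∃ n, ω n ∉ D} ≤ ((κ ^ n) x₀).real D := fun n => by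
      rw [← hP.map_eval n, map_measureReal_apply (measurable_pi_apply n) hD]
      refine measureReal_mono ?_
      intro ω hω
      by_contra hn
      exact hω ⟨n, hn⟩
    have h0 := ge_of_tendsto' hlim hle
    exact (measureReal_eq_zero_iff).1 (le_antisymm h0 measureReal_nonneg)
  have hconv : ∀ᵐ ω ∂P, Filter.Tendsto (fun n => f (ω n)) Filter.atTop
      (nhds (exitVal (O \ D) f ω)) := by
    filter_upwards [hmemO, hexit, hP.ae_succ_eq hD hκD] with ω h1 h2 h3
    have hex : ∃ n, ω n ∈ O \ D := h2.imp fun n hn => ⟨h1 n, hn⟩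
    obtain ⟨hm, hval⟩ := exitVal_of_mem (F := f) hex
    rw [hval]
    refine tendsto_const_nhds.congr' ?_
    filter_upwards [Filter.eventually_ge_atTop (sInf {n | ω n ∈ O \ D})] with n hn
    congr 1
    induction n, hn using Nat.le_induction with
    | base => rfl
    | succ n hn ih => rw [h3 n (ih ▸ hm.2), ← ih]
  have hfm : ∀ n, Measurable fun ω : ℕ → EucN N => f (ω n) := fun n =>
    hf.comp (measurable_pi_apply n)
  have hmeas : AEStronglyMeasurable (exitVal (O \ D) f) P :=
    aestronglyMeasurable_of_tendsto_ae Filter.atTop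
      (fun n => (hfm n).aestronglyMeasurable) hconv
  have hbound : ∀ᵐ ω ∂P, ‖exitVal (O \ D) f ω‖ ≤ C := by
    filter_upwards [hconv] with ω hω
    exact le_of_tendsto' hω.norm fun n => hC _
  refine ⟨Integrable.of_bound hmeas C hbound, ?_⟩
  refine le_of_tendsto' (tendsto_integral_of_dominated_convergence (fun _ => C)
    (fun n => (hfm n).aestronglyMeasurable) (integrable_const C)
    (fun n => Filter.Eventually.of_forall fun ω => hC _) hconv) fun n => ?_
  have := integral_kernel_pow_le (κ := κ) hf hC h n x₀
  rwa [← hP.map_eval n, integral_map (measurable_pi_apply n).aemeasurable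
    hf.aestronglyMeasurable] at this

theorem volume_real_ball_pos (x : EucN N) {ε : ℝ} (hε : 0 < ε) : 0 < volume.real (ball x ε) :=
  ENNReal.toReal_pos (measure_ball_pos volume x hε).ne' measure_ball_lt_top.ne

theorem mveOp_linear {q ε : ℝ} (hε : 0 < ε) {v w : EucN N → ℝ} {x : EucN N}
    (hv : IntegrableOn v (ball x ε)) (hw : IntegrableOn w (ball x ε)) (a b c : ℝ) (ξ : EucN N) :
    mveOp q ε (fun y => a * v y + b * w y + c) ξ x =
      a * mveOp q ε v ξ x + b * mveOp q ε w ξ x + c := by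
  have hc : IntegrableOn (fun _ => c) (ball x ε) := integrableOn_const measure_ball_lt_top.ne
  have h0 : volume.real (ball x ε) ≠ 0 :=
    (volume_real_ball_pos x hε).ne'
  have hvw : IntegrableOn (fun y => a * v y + b * w y) (ball x ε) :=
    (hv.const_mul a).add (hw.const_mul b)
  unfold mveOp
  rw [setAverage_eq, integral_add hvw hc,
    integral_add (hv.const_mul a) (hw.const_mul b), integral_const_mul, integral_const_mul,
    setAverage_eq, setAverage_eq, setIntegral_const]
  simp only [smul_eq_mul]
  field_simp
  ring

theorem integrableOn_ball_of_continuous {f : EucN N → ℝ} (hf : Continuous f) (x : EucN N)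
    (ε : ℝ) : IntegrableOn f (ball x ε) :=
  (hf.continuousOn.integrableOn_compact (isCompact_closedBall x ε)).mono_set ball_subset_closedBall

theorem mveOp_norm_sq {q ε : ℝ} (hε : 0 < ε) {ξ : EucN N} (hξ : ‖ξ‖ = 1) (x : EucN N) :
    mveOp q ε (fun y => ‖y‖ ^ 2) ξ x =
      ‖x‖ ^ 2 + (q * (⨍ z in ball (0 : EucN N) ε, ‖z‖ ^ 2) + (1 - q) * ε ^ 2) := by
  have h0 : volume.real (ball (0 : EucN N) ε) ≠ 0 := (volume_real_ball_pos _ hε).ne'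
  have havg : (⨍ y in ball x ε, ‖y‖ ^ 2) =
      ‖x‖ ^ 2 + ⨍ z in ball (0 : EucN N) ε, ‖z‖ ^ 2 := by
    have htr : ∫ y in ball x ε, ‖y‖ ^ 2 = ∫ z in ball (0 : EucN N) ε, ‖x + z‖ ^ 2 := by
      rw [← (measurePreserving_add_left volume x).setIntegral_preimage_emb
        (measurableEmbedding_addLeft x) (fun y => ‖y‖ ^ 2) (ball x ε)]
      simp
    have hodd : ∫ z in ball (0 : EucN N) ε, inner ℝ x z = 0 := by
      have := (Measure.measurePreserving_neg (volume : Measure (EucN N))).setIntegral_preimage_emb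
        (MeasurableEquiv.neg (EucN N)).measurableEmbedding (fun z => inner ℝ x z)
        (ball (0 : EucN N) ε)
      simp only [neg_preimage, neg_ball, neg_zero, inner_neg_right, integral_neg] at this
      linarith
    have hi1 : IntegrableOn (fun _ : EucN N => ‖x‖ ^ 2) (ball 0 ε) :=
      integrableOn_ball_of_continuous (by fun_prop) _ _
    have hi2 : IntegrableOn (fun z : EucN N => 2 * inner ℝ x z) (ball 0 ε) :=
      integrableOn_ball_of_continuous (by fun_prop) _ _
    have hi3 : IntegrableOn (fun z : EucN N => ‖z‖ ^ 2) (ball 0 ε) :=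
      integrableOn_ball_of_continuous (by fun_prop) _ _
    have hi12 : IntegrableOn (fun z : EucN N => ‖x‖ ^ 2 + 2 * inner ℝ x z) (ball 0 ε) :=
      hi1.add hi2
    rw [setAverage_eq, setAverage_eq, htr]
    simp_rw [norm_add_sq_real]
    rw [integral_add hi12 hi3, integral_add hi1 hi2, integral_const_mul, hodd,
      setIntegral_const, measureReal_def, Measure.addHaar_ball_center volume x ε,
      ← measureReal_def]
    simp only [smul_eq_mul]
    field_simp
    ring
  have hpm : ‖x + ε • ξ‖ ^ 2 + ‖x - ε • ξ‖ ^ 2 = 2 * (‖x‖ ^ 2 + ε ^ 2) := by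
    rw [norm_add_sq_real, norm_sub_sq_real, norm_smul, hξ, Real.norm_eq_abs, mul_one, sq_abs]
    ring
  unfold mveOp
  simp only [havg, hpm]
  ring

theorem setAverage_ball_norm_sq_pos [NeZero N] {ε : ℝ} (hε : 0 < ε) :
    0 < ⨍ z in ball (0 : EucN N) ε, ‖z‖ ^ 2 := by
  rw [setAverage_eq, smul_eq_mul]
  refine mul_pos (inv_pos.2 (volume_real_ball_pos _ hε)) ?_
  rw [setIntegral_pos_iff_support_of_nonneg_ae (Filter.Eventually.of_forall fun _ => by positivity)
    (integrableOn_ball_of_continuous (by fun_prop) _ _)]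
  have hsupp : Function.support (fun z : EucN N => ‖z‖ ^ 2) = {0}ᶜ := by
    ext z; simp
  rw [hsupp, inter_comm, ← sdiff_eq_compl_inter.trans (inter_comm _ _)]
  rw [measure_sdiff_null (measure_singleton _)]
  exact measure_ball_pos volume _ hε

theorem isClosed_Oeps (Ω : Set (EucN N)) (ε : ℝ) : IsClosed (Oeps Ω ε) :=
  isClosed_le (continuous_infDist_pt Ω) continuous_const

theorem mem_Oeps_of_dist_le {Ω : Set (EucN N)} {ε : ℝ} {x y : EucN N} (hx : x ∈ closure Ω)
    (h : dist y x ≤ ε) : y ∈ Oeps Ω ε := by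
  have h1 := infDist_le_infDist_add_dist (s := Ω) (x := y) (y := x)
  rw [infDist_zero_of_mem_closure hx, zero_add] at h1
  exact h1.trans h

theorem closure_subset_Oeps (Ω : Set (EucN N)) {ε : ℝ} (hε : 0 < ε) : closure Ω ⊆ Oeps Ω ε :=
  fun x hx => mem_Oeps_of_dist_le hx (by simpa using hε.le)

theorem ball_subset_Oeps {Ω : Set (EucN N)} {ε : ℝ} {x : EucN N} (hx : x ∈ closure Ω) :
    ball x ε ⊆ Oeps Ω ε :=
  fun _ hy => mem_Oeps_of_dist_le hx (mem_ball.1 hy).le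

theorem add_sub_mem_Oeps {Ω : Set (EucN N)} {ε : ℝ} (hε : 0 < ε) {x : EucN N}
    (hx : x ∈ closure Ω) {ξ : EucN N} (hξ : ‖ξ‖ = 1) :
    x + ε • ξ ∈ Oeps Ω ε ∧ x - ε • ξ ∈ Oeps Ω ε := by
  constructor <;> refine mem_Oeps_of_dist_le hx ?_ <;>
    simp [dist_eq_norm, norm_smul, hξ, abs_of_pos hε]

theorem exists_norm_sq_le_of_mem_Oeps {Ω : Set (EucN N)} (hΩ : Ω.Nonempty)
    (hΩb : Bornology.IsBounded Ω) (ε : ℝ) : ∃ R, ∀ x ∈ Oeps Ω ε, ‖x‖ ^ 2 ≤ R := by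
  obtain ⟨r, hr⟩ := hΩb.exists_norm_le
  refine ⟨(r + (ε + 1)) ^ 2, fun x hx => ?_⟩
  obtain ⟨y, hy, hxy⟩ := (infDist_lt_iff hΩ).1 (lt_of_le_of_lt hx (lt_add_one ε))
  have h1 : ‖x‖ ≤ ‖y‖ + dist x y := by
    simpa [dist_eq_norm] using norm_add_le y (x - y)
  have h2 := hr y hy
  gcongr
  linarith

theorem gamKer_compl_Oeps {q ε : ℝ} (hε : 0 < ε) {Ω : Set (EucN N)} {σ : EucN N → EucN N}
    (hσ : IsControl σ) {x : EucN N} (hx : x ∈ Oeps Ω ε) :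
    gamKer q ε Ω σ x (Oeps Ω ε)ᶜ = 0 := by
  have hm := (isClosed_Oeps Ω ε).measurableSet.compl
  unfold gamKer
  split_ifs with h
  · obtain ⟨h1, h2⟩ := add_sub_mem_Oeps hε h (hσ.2 x)
    have h3 : (Oeps Ω ε)ᶜ ∩ ball x ε = ∅ :=
      (disjoint_compl_left_iff_subset.2 (ball_subset_Oeps h)).inter_eq
    simp [Measure.restrict_apply hm, Measure.dirac_apply' _ hm, h1, h2, h3]
  · simp [Measure.dirac_apply' _ hm, hx]

theorem integrableOn_ball_of_abs_le {Ω : Set (EucN N)} {ε : ℝ} {f : EucN N → ℝ}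
    (hf : Measurable f) {C : ℝ} (hC : ∀ x ∈ Oeps Ω ε, |f x| ≤ C) {x : EucN N}
    (hx : x ∈ closure Ω) : IntegrableOn f (ball x ε) := by
  refine Measure.integrableOn_of_bounded (M := C) measure_ball_lt_top.ne
    hf.aestronglyMeasurable ?_
  filter_upwards [ae_restrict_mem measurableSet_ball] with y hy
  exact hC y (ball_subset_Oeps hx hy)

theorem integral_indicator_gamKer {q ε : ℝ} (hq0 : 0 ≤ q) (hq1 : q ≤ 1) (hε : 0 < ε)
    {Ω : Set (EucN N)} {σ : EucN N → EucN N} (hσ : IsControl σ) {f : EucN N → ℝ}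
    (hf : Measurable f) {C : ℝ} (hC : ∀ x ∈ Oeps Ω ε, |f x| ≤ C) {x : EucN N}
    (hx : x ∈ closure Ω) :
    ∫ y, (Oeps Ω ε).indicator f y ∂gamKer q ε Ω σ x = mveOp q ε f (σ x) x := by
  obtain ⟨h1, h2⟩ := add_sub_mem_Oeps hε hx (hσ.2 x)
  rw [integral_gamKer_of_mem hq0 hq1 hε hx]
  · exact mveOp_congr (fun y hy => indicator_of_mem hy f) (ball_subset_Oeps hx) h1 h2
  · exact (integrableOn_ball_of_abs_le hf hC hx).congr_fun
      (fun y hy => (indicator_of_mem (ball_subset_Oeps hx hy) f).symm) measurableSet_ball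

theorem mveOp_drift_pos {q ε : ℝ} (hq0 : 0 < q) (hq1 : q ≤ 1) (hN : 0 < N) (hε : 0 < ε) :
    0 < q * (⨍ z in ball (0 : EucN N) ε, ‖z‖ ^ 2) + (1 - q) * ε ^ 2 := by
  have : NeZero N := ⟨hN.ne'⟩
  have h1 := mul_pos hq0 (setAverage_ball_norm_sq_pos (N := N) hε)
  have h2 : 0 ≤ (1 - q) * ε ^ 2 := mul_nonneg (sub_nonneg.2 hq1) (sq_nonneg ε)
  linarith

theorem integral_exitVal_le_of_mveOp_le {q ε : ℝ} (hq0 : 0 < q) (hq1 : q ≤ 1) (hN : 0 < N)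
    (hε : 0 < ε) {Ω : Set (EucN N)} (hΩ : Ω.Nonempty) (hΩb : Bornology.IsBounded Ω)
    {σ : EucN N → EucN N} (hσ : IsControl σ) {x₀ : EucN N} (hx₀ : x₀ ∈ Oeps Ω ε)
    {P : Measure (ℕ → EucN N)} (hP : IsTrajMeasure (gamKer q ε Ω σ) x₀ P)
    {f : EucN N → ℝ} (hf : Measurable f) {C : ℝ} (hC : ∀ x ∈ Oeps Ω ε, |f x| ≤ C)
    (h : ∀ x ∈ closure Ω, mveOp q ε f (σ x) x ≤ f x) :
    Integrable (exitVal (Geps Ω ε) f) P ∧ ∫ ω, exitVal (Geps Ω ε) f ω ∂P ≤ f x₀ := by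
  have hO := (isClosed_Oeps Ω ε).measurableSet
  have hD : MeasurableSet (closure Ω) := isClosed_closure.measurableSet
  let κ : ProbabilityTheory.Kernel (EucN N) (EucN N) :=
    ⟨gamKer q ε Ω σ, measurable_gamKer hσ.1⟩
  have hκ : ∀ x, κ x = gamKer q ε Ω σ x := fun _ => rfl
  have : ProbabilityTheory.IsMarkovKernel κ :=
    ⟨fun x => isProbabilityMeasure_gamKer hq0.le hq1 hε Ω σ x⟩
  have hκD : ∀ x ∉ closure Ω, κ x = Measure.dirac x := fun x hx => if_neg hx
  have hbd : ∀ {g : EucN N → ℝ} {C : ℝ}, (∀ x ∈ Oeps Ω ε, |g x| ≤ C) →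
      ∀ x, |(Oeps Ω ε).indicator g x| ≤ C := fun {g C} hg x => by
    by_cases hx : x ∈ Oeps Ω ε
    · simpa [hx] using hg x hx
    · simpa [hx] using (abs_nonneg _).trans (hg x₀ hx₀)
  have hlim : Filter.Tendsto (fun n => ((κ ^ n) x₀).real (closure Ω)) Filter.atTop (nhds 0) := by
    obtain ⟨R, hR⟩ := exists_norm_sq_le_of_mem_Oeps hΩ hΩb ε
    have hm : Measurable fun x : EucN N => -‖x‖ ^ 2 := by fun_prop
    have hb : ∀ x ∈ Oeps Ω ε, |-‖x‖ ^ 2| ≤ R := fun x hx => by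
      rw [abs_neg, abs_of_nonneg (by positivity)]
      exact hR x hx
    refine tendsto_kernel_pow_zero (hm.indicator hO) (hbd hb)
      (mveOp_drift_pos hq0 hq1 hN hε) hD (fun x => ?_) x₀
    by_cases hx : x ∈ closure Ω
    · rw [hκ, integral_indicator_gamKer hq0.le hq1 hε hσ hm hb hx, indicator_of_mem hx,
        indicator_of_mem (closure_subset_Oeps Ω hε hx)]
      have hi : IntegrableOn (fun y : EucN N => ‖y‖ ^ 2) (ball x ε) :=
        integrableOn_ball_of_continuous (by fun_prop) _ _
      have := mveOp_linear (q := q) hε hi hi (-1) 0 0 (σ x)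
      simp only [neg_mul, one_mul, zero_mul, add_zero] at this
      rw [this, mveOp_norm_sq hε (hσ.2 x)]
      linarith
    · rw [hκD x hx, integral_dirac, indicator_of_notMem hx, sub_zero]
  have key := IsTrajMeasure.integral_exitVal_le (κ := κ) hP hD hO hx₀ hκD
    (fun x hx => gamKer_compl_Oeps hε hσ hx) hlim (hf.indicator hO) (hbd hC) fun x => by
      by_cases hx : x ∈ closure Ω
      · rw [hκ, integral_indicator_gamKer hq0.le hq1 hε hσ hf hC hx,
          indicator_of_mem (closure_subset_Oeps Ω hε hx)]
        exact h x hx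
      · rw [hκD x hx, integral_dirac]
  rw [indicator_of_mem hx₀, exitVal_congr
    (fun y hy => indicator_of_mem hy.1 f : EqOn _ f (Oeps Ω ε \ closure Ω))] at key
  exact key

theorem bddAbove_range_mveOp {q ε : ℝ} (hq1 : q ≤ 1) (hε : 0 < ε) {Ω : Set (EucN N)}
    {f : EucN N → ℝ} {C : ℝ} (hC : ∀ x ∈ Oeps Ω ε, |f x| ≤ C) {x : EucN N}
    (hx : x ∈ closure Ω) :
    BddAbove (range fun ξ : sphere (0 : EucN N) 1 => mveOp q ε f (ξ : EucN N) x) := by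
  refine ⟨q * (⨍ y in ball x ε, f y) + (1 - q) * ((C + C) / 2), ?_⟩
  rintro _ ⟨ξ, rfl⟩
  obtain ⟨h1, h2⟩ := add_sub_mem_Oeps hε hx (mem_sphere_zero_iff_norm.1 ξ.2)
  have := sub_nonneg.2 hq1
  simp only [mveOp]
  gcongr
  · exact (le_abs_self _).trans (hC _ h1)
  · exact (le_abs_self _).trans (hC _ h2)

theorem isSigmaCompact_inter_of_isClosed_of_isOpen {A U : Set (EucN N)} (hA : IsClosed A)
    (hU : IsOpen U) : IsSigmaCompact (A ∩ U) := by
  rw [isSigmaCompact_iff_sigmaCompactSpace]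
  have : LocallyCompactSpace (A ∩ U : Set (EucN N)) :=
    (hA.isLocallyClosed.inter hU.isLocallyClosed).locallyCompactSpace
  infer_instance

theorem IsMVS.isSigmaCompact {q ε : ℝ} {Ω : Set (EucN N)} {F v : EucN N → ℝ}
    (hv : IsMVS q ε Ω F v) (hε : 0 < ε) (hF : ContinuousOn F (Geps Ω ε)) (r : ℝ) :
    IsSigmaCompact (Oeps Ω ε ∩ {y | r < v y}) := by
  obtain ⟨U, hU, hUv⟩ := lowerSemicontinuousOn_iff_preimage_Ioi.1 hv.2.2.2.1 r
  obtain ⟨W, hW, hWF⟩ := continuousOn_iff'.1 hF (Ioi r) isOpen_Ioi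
  have h : Oeps Ω ε ∩ {y | r < v y} =
      (closure Ω ∩ U) ∪ (Oeps Ω ε ∩ ((closure Ω)ᶜ ∩ W)) := by
    ext y
    have h1 : y ∈ closure Ω ∧ r < v y ↔ y ∈ closure Ω ∧ y ∈ U := Set.ext_iff.1 hUv y
    have h2 : r < F y ∧ y ∈ Geps Ω ε ↔ y ∈ W ∧ y ∈ Geps Ω ε := Set.ext_iff.1 hWF y
    by_cases hy : y ∈ closure Ω
    · have := closure_subset_Oeps Ω hε hy
      simp_all
    · by_cases hyO : y ∈ Oeps Ω ε
      · have hG : y ∈ Geps Ω ε := ⟨hyO, hy⟩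
        have := hv.2.2.1 hG
        simp_all
      · simp [hy, hyO]
  rw [h]
  rw [union_eq_iUnion]
  refine isSigmaCompact_iUnion _ fun b => ?_
  cases b
  · exact isSigmaCompact_inter_of_isClosed_of_isOpen (isClosed_Oeps Ω ε)
      (isClosed_closure.isOpen_compl.inter hW)
  · exact isSigmaCompact_inter_of_isClosed_of_isOpen isClosed_closure hU

theorem IsMVS.integral_exitVal_le {q ε : ℝ} (hq0 : 0 < q) (hq1 : q ≤ 1) (hN : 0 < N)
    (hε : 0 < ε) {Ω : Set (EucN N)} (hΩ : Ω.Nonempty) (hΩb : Bornology.IsBounded Ω)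
    {F v : EucN N → ℝ} (hv : IsMVS q ε Ω F v)
    {σ : EucN N → EucN N} (hσ : IsControl σ) {x₀ : EucN N} (hx₀ : x₀ ∈ Oeps Ω ε)
    {P : Measure (ℕ → EucN N)} (hP : IsTrajMeasure (gamKer q ε Ω σ) x₀ P) :
    Integrable (exitVal (Geps Ω ε) v) P ∧ ∫ ω, exitVal (Geps Ω ε) v ω ∂P ≤ v x₀ := by
  obtain ⟨hvm, ⟨C, hC⟩, -, -, hvM⟩ := hv
  refine integral_exitVal_le_of_mveOp_le hq0 hq1 hN hε hΩ hΩb hσ hx₀ hP hvm hC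
    fun x hx => ?_
  rw [hvM x hx]
  exact le_ciSup (bddAbove_range_mveOp hq1 hε hC hx)
    (⟨σ x, mem_sphere_zero_iff_norm.2 (hσ.2 x)⟩ : sphere (0 : EucN N) 1)

theorem IsMVS.exists_control_lt_integral_exitVal {q ε : ℝ} (hq0 : 0 < q) (hq1 : q ≤ 1)
    (hN : 0 < N) (hε : 0 < ε) {Ω : Set (EucN N)} (hΩ : Ω.Nonempty)
    (hΩb : Bornology.IsBounded Ω) {F v : EucN N → ℝ} (hv : IsMVS q ε Ω F v)
    (hF : ContinuousOn F (Geps Ω ε)) {x₀ : EucN N} (hx₀ : x₀ ∈ Oeps Ω ε) {w : ℝ}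
    (hw : w < v x₀) :
    ∃ (σ : EucN N → EucN N) (P : Measure (ℕ → EucN N)), IsControl σ ∧
      IsTrajMeasure (gamKer q ε Ω σ) x₀ P ∧ w < ∫ ω, exitVal (Geps Ω ε) F ω ∂P := by
  have hS := hv.isSigmaCompact hε hF
  obtain ⟨hvm, ⟨C, hC⟩, hvF, -, hvM⟩ := id hv
  obtain ⟨R, hR⟩ := exists_norm_sq_le_of_mem_Oeps hΩ hΩb ε
  have hR0 : 0 ≤ R := (sq_nonneg _).trans (hR x₀ hx₀)
  obtain ⟨η, hη, hηw⟩ : ∃ η > 0, w < v x₀ - η * R := by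
    refine ⟨(v x₀ - w) / (R + 1), by have := sub_pos.2 hw; positivity, ?_⟩
    have := sub_pos.2 hw
    have h1 : (v x₀ - w) / (R + 1) * R < v x₀ - w := by
      rw [div_mul_eq_mul_div, div_lt_iff₀ (by linarith)]
      nlinarith
    linarith
  have hc := mveOp_drift_pos (N := N) hq0 hq1 hN hε
  set c := q * (⨍ z in ball (0 : EucN N) ε, ‖z‖ ^ 2) + (1 - q) * ε ^ 2 with hcdef
  have : NeZero N := ⟨hN.ne'⟩
  have : Nonempty (sphere (0 : EucN N) 1) :=
    (NormedSpace.sphere_nonempty.2 zero_le_one).to_subtype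
  obtain ⟨σ, hσ, hσv⟩ := exists_nearOptimal_control hq1 hN (isClosed_closure (s := Ω)) hvm
    (fun x hx ξ hξ => add_sub_mem_Oeps hε hx hξ) hS (a := fun x => v x - η * c)
    (hvm.sub_const _) fun x hx => by
      have hlt : v x - η * c < mvOp q ε v x := by
        rw [← hvM x hx]
        linarith [mul_pos hη hc]
      obtain ⟨ξ, hξ⟩ := exists_lt_of_lt_ciSup hlt
      exact ⟨ξ, mem_sphere_zero_iff_norm.1 ξ.2, hξ⟩
  let κ : ProbabilityTheory.Kernel (EucN N) (EucN N) :=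
    ⟨gamKer q ε Ω σ, measurable_gamKer hσ.1⟩
  have : ProbabilityTheory.IsMarkovKernel κ :=
    ⟨fun x => isProbabilityMeasure_gamKer hq0.le hq1 hε Ω σ x⟩
  obtain ⟨P, hP⟩ := exists_isTrajMeasure κ x₀
  replace hP : IsTrajMeasure (gamKer q ε Ω σ) x₀ P := hP
  refine ⟨σ, P, hσ, hP, ?_⟩
  let f : EucN N → ℝ := fun y => -1 * v y + -η * ‖y‖ ^ 2 + η * R
  have hfm : Measurable f := by fun_prop
  have hfv : ∀ y ∈ Oeps Ω ε, -v y ≤ f y ∧ f y ≤ -v y + η * R := fun y hy => by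
    have h1 : η * ‖y‖ ^ 2 ≤ η * R := by gcongr; exact hR y hy
    have h2 : 0 ≤ η * ‖y‖ ^ 2 := by positivity
    simp only [f]
    constructor <;> linarith
  have hfC : ∀ y ∈ Oeps Ω ε, |f y| ≤ C + η * R := fun y hy => by
    have h1 := hfv y hy
    have h2 := abs_le.1 (hC y hy)
    have h3 : 0 ≤ η * R := by positivity
    rw [abs_le]
    constructor <;> linarith
  obtain ⟨hint, hle⟩ := integral_exitVal_le_of_mveOp_le hq0 hq1 hN hε hΩ hΩb hσ hx₀ hP hfm hfC
    fun x hx => by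
      have h1 := mveOp_linear (q := q) hε (integrableOn_ball_of_abs_le hvm hC hx)
        (integrableOn_ball_of_continuous (f := fun y : EucN N => ‖y‖ ^ 2) (by fun_prop) x ε)
        (-1) (-η) (η * R) (σ x)
      rw [mveOp_norm_sq hε (hσ.2 x), ← hcdef] at h1
      have h2 := hσv x hx
      simp only [f]
      rw [h1]
      linarith
  have hneg : -∫ ω, exitVal (Geps Ω ε) v ω ∂P ≤ ∫ ω, exitVal (Geps Ω ε) f ω ∂P := by
    rw [← integral_neg]
    refine integral_mono
      (hv.integral_exitVal_le hq0 hq1 hN hε hΩ hΩb hσ hx₀ hP).1.neg hint fun ω => ?_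
    by_cases hω : ∃ n, ω n ∈ Geps Ω ε
    · simp only
      rw [(exitVal_of_mem hω).2, (exitVal_of_mem hω).2]
      exact (hfv _ (exitVal_of_mem (F := v) hω).1.1).1
    · simp [exitVal, hω]
  rw [← exitVal_congr hvF]
  linarith [(hfv x₀ hx₀).2]

/-- the ε-stochastic solution equals the ε-mean value solution on `Ω_ε`;
in particular it satisfies the dynamic programming principle on `closure Ω`. -/
theorem stochSol_eq_mvs (hN : 2 ≤ N) (p q ε : ℝ) (hp : 2 ≤ p)
    (hq : q = ((N : ℝ) + 2) / ((N : ℝ) + p)) (hε : 0 < ε)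
    (Ω : Set (EucN N)) (hΩo : IsOpen Ω) (hΩb : Bornology.IsBounded Ω)
    (hΩc : IsConnected Ω) (δbar μ : ℝ) (hδbar : 0 < δbar) (hμ : μ ∈ Ioo (0 : ℝ) 1)
    (hΩlip : Corkscrew Ω δbar μ)
    (F : EucN N → ℝ) (K : ℝ≥0) (hF : LipschitzOnWith K F (Geps Ω ε))
    (hFb : ∃ C, ∀ x ∈ Geps Ω ε, |F x| ≤ C)
    (v : EucN N → ℝ) (hv : IsMVS q ε Ω F v) :
    (∀ x ∈ Oeps Ω ε, stochSol q ε Ω F x = v x) ∧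
      ∀ x ∈ closure Ω, stochSol q ε Ω F x = mvOp q ε (stochSol q ε Ω F) x := by
  have hN0 : 0 < N := by lia
  have hNp : 0 < (N : ℝ) + p := by positivity
  have hq0 : 0 < q := by rw [hq]; positivity
  have hq1 : q ≤ 1 := by rw [hq, div_le_one hNp]; linarith
  have hΩ := hΩc.nonempty
  have heq : EqOn (stochSol q ε Ω F) v (Oeps Ω ε) := fun x hx => by
    refine csSup_eq_of_forall_le_of_forall_lt_exists_gt ?_ ?_ ?_
    · obtain ⟨σ, P, hσ, hP, -⟩ := hv.exists_control_lt_integral_exitVal hq0 hq1 hN0 hε hΩ hΩb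
        hF.continuousOn hx (sub_one_lt (v x))
      exact ⟨_, σ, P, hσ, hP, rfl⟩
    · rintro _ ⟨σ, P, hσ, hP, rfl⟩
      rw [← exitVal_congr hv.2.2.1]
      exact (hv.integral_exitVal_le hq0 hq1 hN0 hε hΩ hΩb hσ hx hP).2
    · intro w hw
      obtain ⟨σ, P, hσ, hP, hlt⟩ := hv.exists_control_lt_integral_exitVal hq0 hq1 hN0 hε hΩ hΩb
        hF.continuousOn hx hw
      exact ⟨_, ⟨σ, P, hσ, hP, rfl⟩, hlt⟩
  refine ⟨heq, fun x hx => ?_⟩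
  rw [heq (closure_subset_Oeps Ω hε hx), hv.2.2.2.2 x hx]
  refine iSup_congr fun ξ => ?_
  obtain ⟨h1, h2⟩ := add_sub_mem_Oeps hε hx (mem_sphere_zero_iff_norm.1 ξ.2)
  exact (mveOp_congr heq (ball_subset_Oeps hx) h1 h2).symm


end
end

section
/- Given η > 0, there exist δ = δ(η,F,δ̄) > 0, k₀ = k₀(η,μ,p,F) ∈ ℕ and ε₀ = ε₀(η,δ,μ,k₀) > 0 such that u_ε(x) − F(y) ≤ η/2 for all y ∈ ∂Ω, all x ∈ B_{δ/4^{k₀}}(y) ∩ closure(Ω), and all 0 < ε ≤ ε₀. Here u_ε denotes the ε-stochastic (equivalently ε-mean value) solution with boundary data F, and F is extended to ∂Ω by continuity (Lipschitz extension). -/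
open MeasureTheory Metric Set
open scoped ENNReal NNReal Classical

noncomputable section

variable {N : ℕ}

/-- The radial profile `‖x - z‖^{-2n}`, which is singular at `z`. -/
def radialPow (z : EucN N) (n : ℕ) (x : EucN N) : ℝ := ((‖x - z‖ ^ 2)⁻¹) ^ n

lemma one_add_sq_le_even_part (t : ℝ) (n : ℕ) :
    n * t ^ 2 ≤ t * (((1 + t) ^ n - (1 - t) ^ n) / 2) ∧
      1 + (n * (n - 1) : ℝ) / 2 * t ^ 2 ≤ ((1 + t) ^ n + (1 - t) ^ n) / 2 := by
  induction n with
  | zero => simp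
  | succ k ih =>
    obtain ⟨h1, h2⟩ := ih
    have hE : 1 ≤ ((1 + t) ^ k + (1 - t) ^ k) / 2 := by
      refine le_trans ?_ h2
      have : (0 : ℝ) ≤ (k : ℝ) * (k - 1) := by
        rcases Nat.eq_zero_or_pos k with rfl | hk
        · simp
        · have : (1 : ℝ) ≤ k := by exact_mod_cast hk
          nlinarith
      nlinarith [mul_nonneg this (sq_nonneg t)]
    rw [pow_succ (1 + t), pow_succ (1 - t)]
    push_cast
    constructor
    · nlinarith [mul_le_mul_of_nonneg_left hE (sq_nonneg t)]
    · nlinarith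

lemma inv_pow_mul_le_symm_mean {a b : ℝ} (h1 : 0 < a + b) (h2 : 0 < a - b) (n : ℕ) :
    (a⁻¹) ^ n * (1 + (n * (n - 1) : ℝ) / 2 * (b / a) ^ 2) ≤
      (((a + b)⁻¹) ^ n + ((a - b)⁻¹) ^ n) / 2 := by
  have ha : 0 < a := by linarith
  have key : ∀ c : ℝ, 0 < a + c → a⁻¹ * (1 - c / a) ≤ (a + c)⁻¹ := by
    intro c hc
    rw [← one_div (a + c), le_div_iff₀ hc]
    have : a⁻¹ * (1 - c / a) * (a + c) = 1 - (c / a) ^ 2 := by field_simp; ring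
    nlinarith [sq_nonneg (c / a)]
  have hp : (a⁻¹) ^ n * (1 - b / a) ^ n ≤ ((a + b)⁻¹) ^ n := by
    rw [← mul_pow]
    refine pow_le_pow_left₀ (mul_nonneg (by positivity) ?_) (key b h1) n
    rw [sub_nonneg, div_le_one ha]; linarith
  have hm : (a⁻¹) ^ n * (1 + b / a) ^ n ≤ ((a - b)⁻¹) ^ n := by
    rw [← mul_pow]
    have := key (-b) (by linarith)
    rw [neg_div, sub_neg_eq_add, ← sub_eq_add_neg] at this
    refine pow_le_pow_left₀ (mul_nonneg (by positivity) ?_) this n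
    have : 0 ≤ (a + b) / a := by positivity
    rwa [add_div, div_self ha.ne'] at this
  have := mul_le_mul_of_nonneg_left (one_add_sq_le_even_part (b / a) n).2
    (by positivity : 0 ≤ (a⁻¹) ^ n)
  linarith

lemma inv_pow_mul_one_sub_le {r h : ℝ} (hr : 0 < r) (hh : 0 ≤ h) (hhr : h ≤ r) (n : ℕ) :
    (r⁻¹) ^ n * (1 - n * (h / r)) ≤ ((r + h)⁻¹) ^ n := by
  have hle : h / r ≤ 1 := (div_le_one hr).2 hhr
  have h0 : 0 ≤ h / r := by positivity
  have base : r⁻¹ * (1 - h / r) ≤ (r + h)⁻¹ := by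
    rw [← one_div (r + h), le_div_iff₀ (by positivity)]
    have : r⁻¹ * (1 - h / r) * (r + h) = 1 - (h / r) ^ 2 := by field_simp; ring
    nlinarith [sq_nonneg (h / r)]
  calc (r⁻¹) ^ n * (1 - n * (h / r)) ≤ (r⁻¹) ^ n * (1 - h / r) ^ n := by
        gcongr
        have := one_add_mul_le_pow (a := -(h / r)) (by linarith) n
        simpa [sub_eq_add_neg] using this
    _ = (r⁻¹ * (1 - h / r)) ^ n := (mul_pow _ _ _).symm
    _ ≤ _ := pow_le_pow_left₀ (mul_nonneg (by positivity) (by linarith)) base n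

lemma radialPow_symm_mean_ge {z x h : EucN N} {ε : ℝ} {n : ℕ} (hn : 1 ≤ n) (hε : 0 < ε)
    (hεx : 2 * n * ε ^ 2 ≤ ‖x - z‖ ^ 2) (hh : ‖h‖ ≤ ε) :
    radialPow z n x * (1 - n * (ε ^ 2 / ‖x - z‖ ^ 2)) ≤
        (radialPow z n (x + h) + radialPow z n (x - h)) / 2 ∧
      (‖x - z‖ * ε / 4 ≤ |inner ℝ (x - z) h| →
        radialPow z n x * (1 - n * (ε ^ 2 / ‖x - z‖ ^ 2)) +
          radialPow z n x * ((n * (n - 1) : ℝ) / 64 * (ε ^ 2 / ‖x - z‖ ^ 2)) ≤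
        (radialPow z n (x + h) + radialPow z n (x - h)) / 2) := by
  have hn1 : (1 : ℝ) ≤ n := by exact_mod_cast hn
  set w := x - z with hw
  have e1 : ‖x + h - z‖ ^ 2 = (‖w‖ ^ 2 + ‖h‖ ^ 2) + 2 * inner ℝ w h := by
    rw [show x + h - z = w + h by rw [hw]; abel, norm_add_sq_real]; ring
  have e2 : ‖x - h - z‖ ^ 2 = (‖w‖ ^ 2 + ‖h‖ ^ 2) - 2 * inner ℝ w h := by
    rw [show x - h - z = w - h by rw [hw]; abel, norm_sub_sq_real]; ring
  have hwpos : 0 < ‖w‖ ^ 2 := lt_of_lt_of_le (by positivity) hεx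
  have hw0 : 0 < ‖w‖ := by
    by_contra hc
    have : ‖w‖ = 0 := le_antisymm (not_lt.1 hc) (norm_nonneg _)
    simp [this] at hwpos
  have hh2 : ‖h‖ ^ 2 ≤ ε ^ 2 := pow_le_pow_left₀ (norm_nonneg _) hh 2
  have hε2 : ε ^ 2 < ‖w‖ ^ 2 := by nlinarith [sq_pos_of_pos hε]
  have hhw : ‖h‖ < ‖w‖ := lt_of_le_of_lt hh (lt_of_pow_lt_pow_left₀ 2 hw0.le hε2)
  have hin := abs_le.1 (abs_real_inner_le_norm w h)
  have hgap : 0 < (‖w‖ - ‖h‖) ^ 2 := by have := sub_pos.2 hhw; positivity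
  set a := ‖w‖ ^ 2 + ‖h‖ ^ 2 with ha
  set b := 2 * inner ℝ w h with hb
  have hab1 : 0 < a + b := by nlinarith
  have hab2 : 0 < a - b := by nlinarith
  have ha0 : 0 < a := by positivity
  have hS := inv_pow_mul_le_symm_mean hab1 hab2 n
  have hA := inv_pow_mul_one_sub_le hwpos (sq_nonneg ‖h‖) (by linarith) n
  unfold radialPow
  rw [e1, e2, ← hw]
  set σ := ε ^ 2 / ‖w‖ ^ 2 with hσ
  have hσ0 : 0 ≤ σ := by positivity
  have hnσ : n * σ ≤ 1 / 2 := by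
    rw [hσ, ← mul_div_assoc, div_le_iff₀ hwpos]; linarith
  set P := ((‖w‖ ^ 2)⁻¹) ^ n with hP
  have hP0 : 0 ≤ P := by positivity
  have hA' : P * (1 - n * σ) ≤ (a⁻¹) ^ n := by
    refine le_trans ?_ hA
    have : ‖h‖ ^ 2 / ‖w‖ ^ 2 ≤ σ := by rw [hσ]; gcongr
    gcongr
  have hn2 : (0 : ℝ) ≤ n * (n - 1) := by nlinarith
  have hC : P * (1 - n * σ) * (1 + (n * (n - 1) : ℝ) / 2 * (b / a) ^ 2) ≤
      ((a + b)⁻¹ ^ n + (a - b)⁻¹ ^ n) / 2 := by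
    refine le_trans ?_ hS
    gcongr
  have hPσ : 0 ≤ P * (1 - n * σ) := mul_nonneg hP0 (by linarith)
  refine ⟨le_trans (le_mul_of_one_le_right hPσ ?_) hC, fun hi => le_trans ?_ hC⟩
  · have : 0 ≤ (n * (n - 1) : ℝ) / 2 * (b / a) ^ 2 := by positivity
    linarith
  · have ht : σ / 16 ≤ (b / a) ^ 2 := by
      have hb2 : ‖w‖ ^ 2 * ε ^ 2 / 4 ≤ b ^ 2 := by
        have := pow_le_pow_left₀ (by positivity) hi 2
        rw [sq_abs] at this
        rw [hb]; nlinarith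
      rw [div_pow, hσ, div_div, div_le_div_iff₀ (by positivity) (by positivity)]
      have ha2 : a ^ 2 ≤ (2 * ‖w‖ ^ 2) ^ 2 := pow_le_pow_left₀ ha0.le (by linarith) 2
      calc ε ^ 2 * a ^ 2 ≤ ε ^ 2 * (2 * ‖w‖ ^ 2) ^ 2 := by gcongr
        _ = ‖w‖ ^ 2 * ε ^ 2 / 4 * (‖w‖ ^ 2 * 16) := by ring
        _ ≤ b ^ 2 * (‖w‖ ^ 2 * 16) := by gcongr
    have h3 : (n * (n - 1) : ℝ) / 32 * σ ≤ (n * (n - 1) : ℝ) / 2 * (b / a) ^ 2 := by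
      have := mul_le_mul_of_nonneg_left ht (by positivity : 0 ≤ (n * (n - 1) : ℝ) / 2)
      linarith
    have h4 := mul_le_mul_of_nonneg_left h3 hPσ
    have h5 : P * ((n * (n - 1) : ℝ) / 64 * σ) ≤
        P * (1 - n * σ) * ((n * (n - 1) : ℝ) / 32 * σ) := by
      rw [mul_assoc]
      refine mul_le_mul_of_nonneg_left ?_ hP0
      have : 0 ≤ (n * (n - 1) : ℝ) / 32 * σ := by positivity
      have := mul_le_mul_of_nonneg_right (by linarith : 1 / 2 ≤ 1 - n * σ) this
      linarith
    linarith

lemma continuousOn_radialPow (z : EucN N) (n : ℕ) : ContinuousOn (radialPow z n) {z}ᶜ := by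
  unfold radialPow
  refine ContinuousOn.pow (ContinuousOn.inv₀ (by fun_prop) ?_) n
  intro x hx
  have : x - z ≠ 0 := sub_ne_zero.2 hx
  positivity

lemma setIntegral_ball_symm (f : EucN N → ℝ) (x : EucN N) (ε : ℝ)
    (hf : IntegrableOn f (ball x ε)) :
    IntegrableOn (fun y => f (2 • x - y)) (ball x ε) ∧
    ∫ y in ball x ε, f (2 • x - y) = ∫ y in ball x ε, f y := by
  have hmp : MeasurePreserving (fun y : EucN N => 2 • x - y) volume volume :=
    Measure.measurePreserving_sub_left volume _
  have hemb : MeasurableEmbedding (fun y : EucN N => 2 • x - y) :=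
    (MeasurableEquiv.subLeft (2 • x)).measurableEmbedding
  have hpre : (fun y : EucN N => 2 • x - y) ⁻¹' ball x ε = ball x ε := by
    ext y
    simp only [mem_preimage, mem_ball, dist_eq_norm]
    rw [show 2 • x - y - x = -(y - x) by rw [two_smul]; abel, norm_neg]
  have h1 := hmp.setIntegral_preimage_emb hemb f (ball x ε)
  have h2 := (hmp.integrableOn_comp_preimage hemb (f := f) (s := ball x ε)).2 hf
  rw [hpre] at h1 h2
  exact ⟨h2, h1⟩

lemma volume_real_ball_quarter (x y : EucN N) (ε : ℝ) :
    volume.real (ball y (ε / 4)) = (1 / 4 : ℝ) ^ N * volume.real (ball x ε) := by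
  rw [show ε / 4 = (1 / 4) * ε by ring, measureReal_def, measureReal_def,
    Measure.addHaar_ball_mul_of_pos volume y (by norm_num : (0 : ℝ) < 1 / 4) ε,
    Measure.addHaar_ball_center volume x ε, ENNReal.toReal_mul,
    ENNReal.toReal_ofReal (by positivity)]
  simp

lemma radialPow_average_ge {z x : EucN N} {ε : ℝ} {n : ℕ} (hn : 1 ≤ n) (hε : 0 < ε)
    (hεx : 2 * n * ε ^ 2 ≤ ‖x - z‖ ^ 2) :
    IntegrableOn (radialPow z n) (ball x ε) ∧
    radialPow z n x * (1 - n * (ε ^ 2 / ‖x - z‖ ^ 2)) + (1 / 4 : ℝ) ^ N *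
          (radialPow z n x * ((n * (n - 1) : ℝ) / 64 * (ε ^ 2 / ‖x - z‖ ^ 2))) ≤
      ⨍ y in ball x ε, radialPow z n y := by
  have hn1 : (1 : ℝ) ≤ n := by exact_mod_cast hn
  have hwpos : 0 < ‖x - z‖ ^ 2 := lt_of_lt_of_le (by positivity) hεx
  have hw0 : 0 < ‖x - z‖ := by
    by_contra hc
    have : ‖x - z‖ = 0 := le_antisymm (not_lt.1 hc) (norm_nonneg _)
    simp [this] at hwpos
  have hεw : ε < ‖x - z‖ := lt_of_pow_lt_pow_left₀ 2 hw0.le (by nlinarith [sq_pos_of_pos hε])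
  have hint : IntegrableOn (radialPow z n) (ball x ε) := by
    refine IntegrableOn.mono_set ?_ ball_subset_closedBall
    refine ContinuousOn.integrableOn_compact (isCompact_closedBall x ε)
      ((continuousOn_radialPow z n).mono ?_)
    rintro y hy rfl
    rw [mem_closedBall, dist_comm, dist_eq_norm] at hy
    linarith
  refine ⟨hint, ?_⟩
  obtain ⟨hint', hsymm⟩ := setIntegral_ball_symm _ x ε hint
  set c₁ := radialPow z n x * (1 - n * (ε ^ 2 / ‖x - z‖ ^ 2)) with hc₁
  set c₂ := radialPow z n x * ((n * (n - 1) : ℝ) / 64 * (ε ^ 2 / ‖x - z‖ ^ 2)) with hc₂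
  set e := (ε / (2 * ‖x - z‖)) • (x - z) with he
  have hne : ‖e‖ = ε / 2 := by
    rw [he, norm_smul, Real.norm_of_nonneg (by positivity)]; field_simp
  set G := ball (x + e) (ε / 4) with hG
  have hGsub : G ⊆ ball x ε := by
    refine ball_subset_ball' ?_
    rw [dist_eq_norm, add_sub_cancel_left, hne]; linarith
  have hmean : ∫ y in ball x ε, radialPow z n y =
      ∫ y in ball x ε, (radialPow z n y + radialPow z n (2 • x - y)) / 2 := by
    rw [integral_div, integral_add hint hint', hsymm]; ring
  have hconst : ∀ c : ℝ, Integrable (fun _ : EucN N => c) (volume.restrict (ball x ε)) :=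
    fun c => integrableOn_const (measure_ball_lt_top).ne (by simp)
  have hlow : ∫ y in ball x ε, (c₁ + G.indicator (fun _ => c₂) y) ≤
      ∫ y in ball x ε, (radialPow z n y + radialPow z n (2 • x - y)) / 2 := by
    refine setIntegral_mono_on ?_ ((hint.add hint').div_const 2) measurableSet_ball ?_
    · exact (hconst c₁).add ((hconst c₂).indicator measurableSet_ball)
    · intro y hy
      rw [mem_ball, dist_eq_norm] at hy
      have hS := radialPow_symm_mean_ge (z := z) hn hε hεx hy.le
      rw [add_sub_cancel, show x - (y - x) = 2 • x - y by rw [two_smul]; abel] at hS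
      by_cases hyG : y ∈ G
      · rw [indicator_of_mem hyG]
        refine hS.2 (le_trans ?_ (le_abs_self _))
        rw [hG, mem_ball, dist_eq_norm] at hyG
        have hi := (abs_le.1 (abs_real_inner_le_norm (x - z) (y - (x + e)))).1
        have hi2 : inner ℝ (x - z) e = ‖x - z‖ * ε / 2 := by
          rw [he, inner_smul_right, real_inner_self_eq_norm_sq]; field_simp
        have hsplit : inner ℝ (x - z) (y - x) =
            inner ℝ (x - z) (y - (x + e)) + inner ℝ (x - z) e := by
          rw [← inner_add_right]; congr 1; abel
        have := mul_le_mul_of_nonneg_left hyG.le hw0.le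
        rw [hsplit, hi2]; linarith
      · rw [indicator_of_notMem hyG, add_zero]
        exact hS.1
  have hval : ∫ y in ball x ε, (c₁ + G.indicator (fun _ => c₂) y) =
      volume.real (ball x ε) * (c₁ + (1 / 4 : ℝ) ^ N * c₂) := by
    rw [integral_add (hconst c₁) ((hconst c₂).indicator measurableSet_ball),
      setIntegral_const, setIntegral_indicator measurableSet_ball,
      inter_eq_self_of_subset_right hGsub, setIntegral_const, hG,
      volume_real_ball_quarter x]
    simp only [smul_eq_mul]; ring
  have hV : 0 < volume.real (ball x ε) := by
    rw [measureReal_def]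
    exact ENNReal.toReal_pos (measure_ball_pos volume x hε).ne' (by finiteness)
  rw [setAverage_eq, smul_eq_mul, hmean, inv_mul_eq_div, le_div_iff₀ hV]
  linarith

lemma radialPow_mveOp_ge {z x ξ : EucN N} {q ε : ℝ} {n : ℕ} (hq0 : 0 < q) (hq1 : q ≤ 1)
    (hn : 1 ≤ n) (hnq : 128 ≤ q * (1 / 4 : ℝ) ^ N * (n - 1)) (hε : 0 < ε)
    (hεx : 2 * n * ε ^ 2 ≤ ‖x - z‖ ^ 2) (hξ : ‖ξ‖ = 1) :
    radialPow z n x * (1 + ε ^ 2 / ‖x - z‖ ^ 2) ≤ mveOp q ε (radialPow z n) ξ x := by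
  have hn1 : (1 : ℝ) ≤ n := by exact_mod_cast hn
  have h1 := (radialPow_average_ge hn hε hεx).2
  have h2 := (radialPow_symm_mean_ge (h := ε • ξ) hn hε hεx
    (by rw [norm_smul, hξ, Real.norm_of_nonneg hε.le, mul_one])).1
  unfold mveOp
  have h3 := mul_le_mul_of_nonneg_left h1 hq0.le
  have h4 := mul_le_mul_of_nonneg_left h2 (sub_nonneg.2 hq1)
  refine le_trans ?_ (add_le_add h3 h4)
  set P := radialPow z n x
  set σ := ε ^ 2 / ‖x - z‖ ^ 2
  have hσ : 0 ≤ σ := by positivity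
  have hP : 0 ≤ P := by simp only [P, radialPow]; positivity
  have h5 := mul_le_mul_of_nonneg_right hnq (by positivity : 0 ≤ P * σ * n / 64)
  have h6 : P * σ ≤ P * σ * n := le_mul_of_one_le_right (by positivity) hn1
  nlinarith

lemma mveOp_sub_mul {q ε a b : ℝ} {f : EucN N → ℝ} {ξ x : EucN N} (hε : 0 < ε)
    (hf : IntegrableOn f (ball x ε)) :
    mveOp q ε (fun y => a - b * f y) ξ x = a - b * mveOp q ε f ξ x := by
  have hV : volume.real (ball x ε) ≠ 0 := by
    rw [measureReal_def]
    exact (ENNReal.toReal_pos (measure_ball_pos volume x hε).ne' (by finiteness)).ne'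
  have hc : Integrable (fun _ : EucN N => a) (volume.restrict (ball x ε)) :=
    integrableOn_const (measure_ball_lt_top).ne (by simp)
  have : ⨍ y in ball x ε, (a - b * f y) = a - b * ⨍ y in ball x ε, f y := by
    rw [setAverage_eq, setAverage_eq, integral_sub hc (hf.const_mul b), setIntegral_const,
      integral_const_mul]
    simp only [smul_eq_mul]
    field_simp
  unfold mveOp
  rw [this]
  ring

lemma mveOp_mono {q ε : ℝ} {f g : EucN N → ℝ} {ξ x : EucN N} (hq0 : 0 ≤ q) (hq1 : q ≤ 1)
    (hε : 0 ≤ ε) (hξ : ‖ξ‖ = 1) (hf : IntegrableOn f (ball x ε))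
    (hg : IntegrableOn g (ball x ε)) (hfg : ∀ y ∈ closedBall x ε, f y ≤ g y) :
    mveOp q ε f ξ x ≤ mveOp q ε g ξ x := by
  have h1 : ⨍ y in ball x ε, f y ≤ ⨍ y in ball x ε, g y := by
    rw [setAverage_eq, setAverage_eq]
    refine smul_le_smul_of_nonneg_left ?_ (by positivity)
    exact setIntegral_mono_on hf hg measurableSet_ball
      fun y hy => hfg y (ball_subset_closedBall hy)
  have h2 := hfg (x + ε • ξ) (by simp [norm_smul, hξ, abs_of_nonneg hε])
  have h3 := hfg (x - ε • ξ) (by simp [norm_smul, hξ, abs_of_nonneg hε])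
  unfold mveOp
  have h4 := sub_nonneg.2 hq1
  gcongr

lemma closedBall_subset_Oeps {Ω : Set (EucN N)} {x : EucN N} {ε : ℝ} (hx : x ∈ closure Ω) :
    closedBall x ε ⊆ Oeps Ω ε := by
  intro y hy
  change infDist y Ω ≤ ε
  rw [← infDist_closure]
  exact (infDist_le_dist_of_mem hx).trans hy

lemma IsMVS.integrableOn_ball {q ε : ℝ} {Ω : Set (EucN N)} {F v : EucN N → ℝ}
    (hv : IsMVS q ε Ω F v) {x : EucN N} (hx : x ∈ closure Ω) : IntegrableOn v (ball x ε) := by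
  obtain ⟨hm, ⟨C, hC⟩, -⟩ := hv
  refine IntegrableOn.of_bound measure_ball_lt_top hm.aestronglyMeasurable C ?_
  refine ae_restrict_of_forall_mem measurableSet_ball fun y hy => ?_
  exact hC y (closedBall_subset_Oeps hx (ball_subset_closedBall hy))

/-- Comparison of a mean value solution with a strict radial supersolution. -/
lemma IsMVS.le_radial (hN : 2 ≤ N) {q ε : ℝ} {Ω : Set (EucN N)} {F v : EucN N → ℝ}
    (hv : IsMVS q ε Ω F v) (hq0 : 0 < q) (hq1 : q ≤ 1) {n : ℕ} (hn : 1 ≤ n)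
    (hnq : 128 ≤ q * (1 / 4 : ℝ) ^ N * (n - 1)) (hε : 0 < ε) {D : Set (EucN N)}
    (hD : D ⊆ closure Ω) {z : EucN N} {R₀ R₁ a b : ℝ} (hR₀ : 0 < R₀)
    (hDR₀ : ∀ x ∈ D, R₀ ≤ ‖x - z‖) (hDR₁ : ∀ x ∈ D, ‖x - z‖ ≤ R₁)
    (hεR : ε ≤ R₀ / (2 * n)) (hb : 0 < b)
    (hout : ∀ x ∈ D, ∀ y ∈ closedBall x ε, y ∉ D → v y ≤ a - b * radialPow z n y) :
    ∀ x ∈ D, v x ≤ a - b * radialPow z n x := by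
  intro x₀ hx₀
  have hn1 : (1 : ℝ) ≤ n := by exact_mod_cast hn
  have hR₁ : 0 < R₁ := hR₀.trans_le ((hDR₀ x₀ hx₀).trans (hDR₁ x₀ hx₀))
  have hεx : ∀ x ∈ D, 2 * n * ε ^ 2 ≤ ‖x - z‖ ^ 2 := by
    intro x hx
    rw [le_div_iff₀ (by positivity)] at hεR
    have h1 : (ε * (2 * n)) ^ 2 ≤ ‖x - z‖ ^ 2 :=
      pow_le_pow_left₀ (by positivity) (hεR.trans (hDR₀ x hx)) 2
    nlinarith [sq_nonneg ε, mul_nonneg (sq_nonneg ε) (sub_nonneg.2 hn1)]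
  have : Nontrivial (EucN N) := by
    have : Nonempty (Fin N) := ⟨⟨0, by omega⟩⟩
    infer_instance
  have : Nonempty (sphere (0 : EucN N) 1) := (NormedSpace.sphere_nonempty.2 zero_le_one).to_subtype
  set c := b * (((R₁ ^ 2)⁻¹) ^ n * (ε ^ 2 / R₁ ^ 2)) with hc
  have hc0 : 0 < c := by positivity
  have hbd : BddAbove ((fun x => v x - (a - b * radialPow z n x)) '' D) := by
    obtain ⟨-, ⟨C, hC⟩, -⟩ := hv
    refine ⟨C - a + b * ((R₀ ^ 2)⁻¹) ^ n, ?_⟩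
    rintro _ ⟨x, hx, rfl⟩
    have h1 := (abs_le.1 (hC x (closedBall_subset_Oeps (hD hx)
      (mem_closedBall_self hε.le)))).2
    have h2 : radialPow z n x ≤ ((R₀ ^ 2)⁻¹) ^ n := by
      unfold radialPow
      have := hDR₀ x hx
      gcongr
    have := mul_le_mul_of_nonneg_left h2 hb.le
    dsimp only
    linarith
  set s := sSup ((fun x => v x - (a - b * radialPow z n x)) '' D) with hs
  have hle : ∀ x ∈ D, v x - (a - b * radialPow z n x) ≤ s :=
    fun x hx => le_csSup hbd ⟨x, hx, rfl⟩
  suffices s ≤ 0 by linarith [hle x₀ hx₀]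
  by_contra! hs0
  have : s ≤ s - c := by
    refine csSup_le ⟨_, x₀, hx₀, rfl⟩ ?_
    rintro _ ⟨x, hx, rfl⟩
    have hmv := hv.2.2.2.2 x (hD hx)
    have hint := (radialPow_average_ge hn hε (hεx x hx)).1
    have hintΦ : IntegrableOn (fun y => (a + s) - b * radialPow z n y) (ball x ε) :=
      Integrable.sub (integrableOn_const (measure_ball_lt_top).ne (by simp)) (hint.const_mul b)
    have hup : mvOp q ε v x ≤ a + s - b * radialPow z n x - c := by
      refine ciSup_le fun ξ => ?_
      have hξ : ‖(ξ : EucN N)‖ = 1 := by simp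
      refine (mveOp_mono hq0.le hq1 hε.le hξ (hv.integrableOn_ball (hD hx)) hintΦ ?_).trans ?_
      · intro y hy
        by_cases hyD : y ∈ D
        · linarith [hle y hyD]
        · linarith [hout x hx y hy hyD]
      · rw [mveOp_sub_mul hε hint]
        have h1 := radialPow_mveOp_ge hq0 hq1 hn hnq hε (hεx x hx) hξ
        have h2 : ((R₁ ^ 2)⁻¹) ^ n * (ε ^ 2 / R₁ ^ 2) ≤
            radialPow z n x * (ε ^ 2 / ‖x - z‖ ^ 2) := by
          have h3 := hDR₁ x hx
          have h4 := hR₀.trans_le (hDR₀ x hx)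
          unfold radialPow
          gcongr
        have h5 := mul_le_mul_of_nonneg_left h1 hb.le
        have h6 := mul_le_mul_of_nonneg_left h2 hb.le
        rw [hc]
        linarith
    dsimp only
    linarith
  linarith

/-- The estimate `u_ε(x) - F(y) ≤ A` holds uniformly near the boundary for small `ε`. -/
def BoundaryUpperBound (Ω : Set (EucN N)) (F : EucN N → ℝ) (u : ℝ → EucN N → ℝ) (A : ℝ) : Prop :=
  ∃ δ > 0, ∃ ε₀ > 0, ∀ y ∈ frontier Ω, ∀ x ∈ ball y δ ∩ closure Ω,
    ∀ ε : ℝ, 0 < ε → ε ≤ ε₀ → u ε x - F y ≤ A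

lemma exists_boundaryUpperBound (hN : 2 ≤ N) {q : ℝ} (hq0 : 0 < q) (hq1 : q ≤ 1)
    {n : ℕ} (hn : 1 ≤ n) (hnq : 128 ≤ q * (1 / 4 : ℝ) ^ N * (n - 1))
    {Ω : Set (EucN N)} (hΩo : IsOpen Ω) (hΩb : Bornology.IsBounded Ω)
    {F : EucN N → ℝ} {K : ℝ≥0} (hF : LipschitzOnWith K F Ωᶜ)
    {u : ℝ → EucN N → ℝ} (hu : ∀ ε : ℝ, 0 < ε → IsMVS q ε Ω F (u ε)) :
    ∃ A > 0, BoundaryUpperBound Ω F u A := by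
  have hn1 : (1 : ℝ) ≤ n := by exact_mod_cast hn
  obtain ⟨R, hR0, hR⟩ := hΩb.closure.subset_closedBall_lt 0 0
  have : Nontrivial (EucN N) := by
    have : Nonempty (Fin N) := ⟨⟨0, by omega⟩⟩
    infer_instance
  obtain ⟨z, hz⟩ := exists_norm_eq (EucN N) (by positivity : 0 ≤ R + 2)
  refine ⟨K * (2 * R + 1) + 1, by positivity, 1, one_pos, 1 / n, by positivity, ?_⟩
  rintro y hy x ⟨-, hx⟩ ε hε hεn
  have hε1 : ε ≤ 1 := hεn.trans (by rw [div_le_one (by positivity)]; exact hn1)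
  have hnorm : ∀ w ∈ closure Ω, ‖w‖ ≤ R := fun w hw => by simpa using hR hw
  have hlow : ∀ w ∈ closure Ω, 2 ≤ ‖w - z‖ := fun w hw => by
    have := norm_sub_norm_le z w
    rw [norm_sub_rev] at this
    linarith [hnorm w hw]
  have hup : ∀ w ∈ closure Ω, ‖w - z‖ ≤ 2 * R + 2 := fun w hw => by
    linarith [norm_sub_le w z, hnorm w hw]
  have hmain := (hu ε hε).le_radial hN hq0 hq1 hn hnq hε (subset_refl (closure Ω)) two_pos
    hlow hup (a := F y + K * (2 * R + 1) + 1) (b := 1)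
    (by rw [show (2 : ℝ) / (2 * n) = 1 / n by field_simp]; exact hεn) one_pos ?_ x hx
  · have : 0 ≤ radialPow z n x := by unfold radialPow; positivity
    linarith
  · intro w hw v hv hvD
    have hvF : u ε v = F v := (hu ε hε).2.2.1 ⟨closedBall_subset_Oeps hw hv, hvD⟩
    have hyΩ : y ∈ Ωᶜ := fun h => hy.2 (by rwa [hΩo.interior_eq])
    have hd := hF.dist_le_mul v (fun h => hvD (subset_closure h)) y hyΩ
    rw [mem_closedBall] at hv
    have hvy : dist v y ≤ 2 * R + 1 := by
      have h1 := dist_triangle v w y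
      have h2 := dist_le_norm_add_norm w y
      linarith [hnorm w hw, hnorm y hy.1]
    have h3 : F v - F y ≤ K * (2 * R + 1) :=
      (le_abs_self _).trans (hd.trans (by gcongr))
    have h4 : radialPow z n v ≤ 1 := by
      unfold radialPow
      refine pow_le_one₀ (by positivity) (inv_le_one_of_one_le₀ (one_le_pow₀ ?_))
      have h5 := dist_triangle w v z
      rw [dist_comm w v, dist_eq_norm w z, dist_eq_norm v z] at h5
      linarith [hlow w hw]
    linarith

lemma pow_mul_radialPow_le_one {z x : EucN N} {n : ℕ} {r : ℝ} (hr : 0 < r) (h : r ≤ ‖x - z‖) :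
    r ^ (2 * n) * radialPow z n x ≤ 1 := by
  have h0 := hr.trans_le h
  unfold radialPow
  rw [pow_mul, ← mul_pow]
  refine pow_le_one₀ (by positivity) ?_
  rw [← div_eq_mul_inv, div_le_one (by positivity)]
  gcongr

lemma BoundaryUpperBound.improve (hN : 2 ≤ N) {q : ℝ} (hq0 : 0 < q) (hq1 : q ≤ 1)
    {n : ℕ} (hn : 1 ≤ n) (hnq : 128 ≤ q * (1 / 4 : ℝ) ^ N * (n - 1))
    {Ω : Set (EucN N)} (hΩo : IsOpen Ω)
    {δbar μ : ℝ} (hδbar : 0 < δbar) (hμ : μ ∈ Ioo (0 : ℝ) 1) (hΩ : Corkscrew Ω δbar μ)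
    {F : EucN N → ℝ} {K : ℝ≥0} (hF : LipschitzOnWith K F Ωᶜ)
    {u : ℝ → EucN N → ℝ} (hu : ∀ ε : ℝ, 0 < ε → IsMVS q ε Ω F (u ε)) :
    ∃ θ ∈ Ioo (0 : ℝ) 1, ∀ A > 0, BoundaryUpperBound Ω F u A → BoundaryUpperBound Ω F u (θ * A) := by
  have hn1 : (1 : ℝ) ≤ n := by exact_mod_cast hn
  obtain ⟨hμ0, hμ1⟩ := hμ
  set s := (μ / 8) ^ (2 * n) with hs
  set t := (μ / 4) ^ (2 * n) with ht
  have hs0 : 0 < s := by positivity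
  have hst : s < t := pow_lt_pow_left₀ (by linarith) (by positivity) (by omega)
  have ht1 : t < 1 := pow_lt_one₀ (by positivity) (by linarith) (by omega)
  set κ := (1 - t) / (1 - s) with hκ
  have hκ0 : 0 < κ := div_pos (by linarith) (by linarith)
  have hκ1 : κ < 1 := by rw [hκ, div_lt_one (by linarith)]; linarith
  refine ⟨(1 + κ) / 2, ⟨by linarith, by linarith⟩, ?_⟩
  rintro A hA ⟨r, hr, ε₀, hε₀, hP⟩
  obtain ⟨δ, hδ0, hδ⟩ : ∃ δ > 0, δ < δbar ∧ 6 * δ < r ∧ K * (6 * δ) ≤ A * ((1 - κ) / 2) := by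
    have hpos : 0 < A * ((1 - κ) / 2) := mul_pos hA (by linarith)
    refine ⟨min (δbar / 2) (min (r / 12) (A * ((1 - κ) / 2) / (6 * (K + 1)))),
      by positivity, ?_, ?_, ?_⟩
    · exact (min_le_left _ _).trans_lt (by linarith)
    · have := (min_le_right (δbar / 2) (min (r / 12) (A * ((1 - κ) / 2) / (6 * (K + 1))))).trans
        (min_le_left _ _)
      linarith
    · have := (min_le_right (δbar / 2) (min (r / 12) (A * ((1 - κ) / 2) / (6 * (K + 1))))).trans
        (min_le_right _ _)
      rw [le_div_iff₀ (by positivity)] at this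
      have h0 : 0 ≤ min (δbar / 2) (min (r / 12) (A * ((1 - κ) / 2) / (6 * (K + 1)))) := by
        positivity
      nlinarith
  obtain ⟨hδ1, hδr, hδK⟩ := hδ
  refine ⟨δ, hδ0, min ε₀ (μ * δ / (2 * n)), by positivity, ?_⟩
  rintro y hy x ⟨hxy, hx⟩ ε hε hεle
  have hε1 : ε ≤ ε₀ := hεle.trans (min_le_left _ _)
  have hε2 : ε ≤ μ * δ / (2 * n) := hεle.trans (min_le_right _ _)
  have hε3 : ε ≤ μ * δ / 2 := by
    refine hε2.trans (div_le_div_of_nonneg_left (by positivity) two_pos (by linarith))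
  have hμδ : μ * δ < δ := by nlinarith
  obtain ⟨z, hz⟩ := hΩ δ hδ0 hδ1 y hy
  have hzy : dist z y < δ := (hz (mem_closedBall_self (by positivity))).1
  have hfar : ∀ w ∈ closure Ω, μ * δ ≤ ‖w - z‖ := by
    intro w hw
    by_contra! hc
    have hdisj : Disjoint (ball z (μ * δ)) Ω :=
      disjoint_left.2 fun v hv => (hz (ball_subset_closedBall hv)).2
    refine disjoint_left.1 (hdisj.closure_right isOpen_ball) ?_ hw
    rwa [mem_ball, dist_eq_norm]
  set ρ := (μ * δ / 2) ^ (2 * n) with hρ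
  have hρ0 : 0 < ρ := by positivity
  set B := A / (1 - s) with hB
  have hB0 : 0 < B := div_pos hA (by linarith)
  have hBs : B * (1 - s) = A := div_mul_cancel₀ _ (by linarith)
  have hBt : B * (1 - t) = κ * A := by rw [hB, hκ]; ring
  have hρs : ρ = s * (4 * δ) ^ (2 * n) := by rw [hρ, hs, ← mul_pow]; congr 1; ring
  have hρt : ρ = t * (2 * δ) ^ (2 * n) := by rw [hρ, ht, ← mul_pow]; congr 1; ring
  have hmain := (hu ε hε).le_radial hN hq0 hq1 hn hnq hε
    (inter_subset_left : closure Ω ∩ ball z (4 * δ) ⊆ closure Ω) (by positivity : 0 < μ * δ)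
    (fun w hw => hfar w hw.1) (R₁ := 4 * δ)
    (fun w hw => by rw [← dist_eq_norm]; exact (mem_ball.1 hw.2).le)
    (a := F y + K * (6 * δ) + B) (b := B * ρ) hε2 (by positivity) ?_ x ?_
  · have hxz : ‖x - z‖ ≤ 2 * δ := by
      rw [← dist_eq_norm]
      rw [mem_ball] at hxy
      have := dist_triangle_right x z y
      linarith
    have hpos : 0 < ‖x - z‖ := lt_of_lt_of_le (by positivity) (hfar x hx)
    have h1 : t ≤ ρ * radialPow z n x := by
      rw [hρt, mul_assoc]
      refine le_mul_of_one_le_right (by linarith) ?_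
      unfold radialPow
      rw [pow_mul, ← mul_pow, ← div_eq_mul_inv]
      refine one_le_pow₀ ?_
      rw [one_le_div (by positivity)]
      gcongr
    have h2 := mul_le_mul_of_nonneg_left h1 hB0.le
    linarith
  · rintro w ⟨hw, hwz⟩ v hv hvD
    rw [mem_closedBall] at hv
    rw [mem_ball] at hwz
    have hvz : μ * δ / 2 ≤ ‖v - z‖ := by
      have h5 := dist_triangle w v z
      rw [dist_comm w v, dist_eq_norm w z, dist_eq_norm v z] at h5
      linarith [hfar w hw]
    have hvy : dist v y ≤ 6 * δ := by
      have h1 := dist_triangle4 v w z y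
      linarith
    by_cases hvΩ : v ∈ closure Ω
    · have hvz4 : 4 * δ ≤ ‖v - z‖ := by
        rw [← dist_eq_norm]
        exact not_lt.1 fun h => hvD ⟨hvΩ, h⟩
      have h1 := hP y hy v ⟨lt_of_le_of_lt hvy hδr, hvΩ⟩ ε hε hε1
      have h2 : ρ * radialPow z n v ≤ s := by
        rw [hρs, mul_assoc]
        exact mul_le_of_le_one_right hs0.le (pow_mul_radialPow_le_one (by positivity) hvz4)
      have h3 := mul_le_mul_of_nonneg_left h2 hB0.le
      have h4 : (0 : ℝ) ≤ K * (6 * δ) := by positivity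
      linarith
    · have hvF : u ε v = F v :=
        (hu ε hε).2.2.1 ⟨closedBall_subset_Oeps hw (mem_closedBall.2 hv), hvΩ⟩
      have hyΩ : y ∈ Ωᶜ := fun h => hy.2 (by rwa [hΩo.interior_eq])
      have hd := hF.dist_le_mul v (fun h => hvΩ (subset_closure h)) y hyΩ
      have h3 : F v - F y ≤ K * (6 * δ) :=
        (le_abs_self _).trans (hd.trans (by gcongr))
      have h2 : ρ * radialPow z n v ≤ 1 := pow_mul_radialPow_le_one (by positivity) hvz
      have h4 := mul_le_mul_of_nonneg_left h2 hB0.le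
      linarith
  · refine ⟨hx, ?_⟩
    rw [mem_ball] at hxy ⊢
    have := dist_triangle_right x z y
    linarith

/-- one-sided boundary estimate: given `η > 0` there are `δ > 0`,
`k₀ ∈ ℕ`, `ε₀ > 0` such that `u_ε(x) − F(y) ≤ η/2` for all `y ∈ ∂Ω`, all
`x ∈ B_{δ/4^{k₀}}(y) ∩ closure Ω`, and all `0 < ε ≤ ε₀`. -/
theorem upper_boundary_estimate (hN : 2 ≤ N) (p q : ℝ) (hp : 2 ≤ p)
    (hq : q = ((N : ℝ) + 2) / ((N : ℝ) + p))
    (Ω : Set (EucN N)) (hΩo : IsOpen Ω) (hΩb : Bornology.IsBounded Ω)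
    (hΩc : IsConnected Ω) (δbar μ : ℝ) (hδbar : 0 < δbar) (hμ : μ ∈ Ioo (0 : ℝ) 1)
    (hΩlip : Corkscrew Ω δbar μ)
    (F : EucN N → ℝ) (K : ℝ≥0) (hF : LipschitzOnWith K F Ωᶜ)
    (u : ℝ → EucN N → ℝ) (hu : ∀ ε : ℝ, 0 < ε → IsMVS q ε Ω F (u ε))
    (η : ℝ) (hη : 0 < η) :
    ∃ δ > 0, ∃ k₀ : ℕ, ∃ ε₀ > 0, ∀ y ∈ frontier Ω,
      ∀ x ∈ ball y (δ / 4 ^ k₀) ∩ closure Ω, ∀ ε : ℝ, 0 < ε → ε ≤ ε₀ →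
        u ε x - F y ≤ η / 2 := by
  have hN0 : (2 : ℝ) ≤ N := by exact_mod_cast hN
  have hq0 : 0 < q := by rw [hq]; apply div_pos <;> linarith
  have hq1 : q ≤ 1 := by rw [hq, div_le_one (by linarith)]; linarith
  obtain ⟨m, hm⟩ := exists_nat_ge (128 / (q * (1 / 4 : ℝ) ^ N))
  have hnq : 128 ≤ q * (1 / 4 : ℝ) ^ N * (((m + 1 : ℕ) : ℝ) - 1) := by
    rw [div_le_iff₀ (by positivity)] at hm
    push_cast
    linarith
  obtain ⟨A, hA, hPA⟩ := exists_boundaryUpperBound hN hq0 hq1 (by omega) hnq hΩo hΩb hF hu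
  obtain ⟨θ, ⟨hθ0, hθ1⟩, hstep⟩ :=
    BoundaryUpperBound.improve hN hq0 hq1 (by omega) hnq hΩo hδbar hμ hΩlip hF hu
  have hiter : ∀ k : ℕ, BoundaryUpperBound Ω F u (θ ^ k * A) := by
    intro k
    induction k with
    | zero => simpa using hPA
    | succ k ih =>
      rw [pow_succ', mul_assoc]
      exact hstep _ (by positivity) ih
  obtain ⟨k, hk⟩ := exists_pow_lt_of_lt_one (by positivity : 0 < η / 2 / A) hθ1
  rw [lt_div_iff₀ hA] at hk
  obtain ⟨δ, hδ, ε₀, hε₀, h⟩ := hiter k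
  refine ⟨δ, hδ, 0, ε₀, hε₀, fun y hy x hx ε hε hε' => ?_⟩
  rw [pow_zero, div_one] at hx
  exact (h y hy x hx ε hε hε').trans hk.le

end
end
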